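/- Let p, q ∈ P₁([0,∞)) with p(0) > 1 and p(∞) > 1, and let w(t) = t^{γ(t)} with γ ∈ P([0,∞)) satisfying γ(0) < 1/p′(0) and γ(∞) < 1/p′(∞). Then the maximal Poisson operator f ↦ sup_{y>0} |P_y f(x)|, where P_y f(x) = ∫_{ℝⁿ} P(x−ξ, y) f(ξ) dξ with Poisson kernel P(x,y) = c_n y (|x|² + y²)^{−(n+1)/2}, is bounded on the weighted variable exponent Lorentz space L^{p(·),q(·)}_w(ℝⁿ). -/

import Mathlib

open MeasureTheory Filter Set Metric
open scoped ENNReal NNReal Topology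

noncomputable section

/-- The non-increasing rearrangement `f*` of `f` with respect to the measure `μ`:
`f*(t) = sup { s ≥ 0 : μ{|f| > s} > t }`. -/
def rearrange {α : Type*} [MeasurableSpace α] (μ : Measure α) (f : α → ℝ) (t : ℝ) : ℝ :=
  sSup {s : ℝ | 0 ≤ s ∧ ENNReal.ofReal t < μ {x | s < |f x|}}

/-- The maximal function of the rearrangement: `f**(t) = (1/t) ∫₀ᵗ f*(s) ds`. -/
def doubleStar {α : Type*} [MeasurableSpace α] (μ : Measure α) (f : α → ℝ) (t : ℝ) : ℝ :=
  (1 / t) * ∫ s in Ioo (0 : ℝ) t, rearrange μ f s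

/-- The Luxemburg norm of `g` in the variable exponent Lebesgue space `L^{q(·)}([0,ℓ])`. -/
def luxNorm (ℓ : ℝ≥0∞) (q : ℝ → ℝ) (g : ℝ → ℝ) : ℝ≥0∞ :=
  sInf {lam : ℝ≥0∞ | 0 < lam ∧
    (∫⁻ t in {t : ℝ | 0 < t ∧ ENNReal.ofReal t < ℓ},
      (ENNReal.ofReal |g t| / lam) ^ q t) ≤ 1}

/-- The class `P([0,ℓ])`: bounded measurable exponents with limits `p0` at `0` and
(if `ℓ = ∞`) `pinf` at `∞`, satisfying log-decay conditions at `0` and at `∞`. -/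
structure ClassP (ℓ : ℝ≥0∞) (p : ℝ → ℝ) (p0 pinf : ℝ) : Prop where
  measurable : Measurable p
  bounded : ∃ M : ℝ, ∀ t : ℝ, 0 ≤ t → ENNReal.ofReal t ≤ ℓ → |p t| ≤ M
  lim_zero : Tendsto p (nhdsWithin 0 (Ioi 0)) (nhds p0)
  decay_zero : ∃ C > 0, ∀ t : ℝ, 0 < t → t ≤ 1 / 2 → |p t - p0| ≤ C / Real.log (1 / t)
  lim_infty : ℓ = ∞ → Tendsto p atTop (nhds pinf)
  decay_infty : ℓ = ∞ → ∃ C > 0, ∀ t : ℝ, 0 ≤ t → |p t - pinf| ≤ C / Real.log (Real.exp 1 + t)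

/-- The class `P_a([0,ℓ]) = P([0,ℓ]) ∩ {p : a < p₋ ≤ p₊ < ∞}`. -/
def ClassPa (a : ℝ) (ℓ : ℝ≥0∞) (p : ℝ → ℝ) (p0 pinf : ℝ) : Prop :=
  ClassP ℓ p p0 pinf ∧
    ∃ pm pM : ℝ, a < pm ∧ ∀ t : ℝ, 0 ≤ t → ENNReal.ofReal t ≤ ℓ → pm ≤ p t ∧ p t ≤ pM

/-- The variable exponent Lorentz norm `‖f‖_{L^{p(·),q(·)}(Ω)}`. -/
def lorentzNorm {α : Type*} [MeasurableSpace α] (μ : Measure α) (p q : ℝ → ℝ)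
    (f : α → ℝ) : ℝ≥0∞ :=
  luxNorm (μ univ) q fun t => t ^ (1 / p t - 1 / q t) * rearrange μ f t

/-- The variable exponent Lorentz norm `‖f‖¹_{L^{p(·),q(·)}(Ω)}` defined via `f**`. -/
def lorentzNorm1 {α : Type*} [MeasurableSpace α] (μ : Measure α) (p q : ℝ → ℝ)
    (f : α → ℝ) : ℝ≥0∞ :=
  luxNorm (μ univ) q fun t => t ^ (1 / p t - 1 / q t) * doubleStar μ f t

/-- The weighted variable exponent Lorentz norm `‖f‖_{L^{p(·),q(·)}_w(Ω)}`. -/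
def wLorentzNorm {α : Type*} [MeasurableSpace α] (μ : Measure α) (w p q : ℝ → ℝ)
    (f : α → ℝ) : ℝ≥0∞ :=
  luxNorm (μ univ) q fun t => w t * t ^ (1 / p t - 1 / q t) * rearrange μ f t

/-- The weighted variable exponent Lorentz norm `‖f‖¹_{L^{p(·),q(·)}_w(Ω)}` via `f**`. -/
def wLorentzNorm1 {α : Type*} [MeasurableSpace α] (μ : Measure α) (w p q : ℝ → ℝ)
    (f : α → ℝ) : ℝ≥0∞ :=
  luxNorm (μ univ) q fun t => w t * t ^ (1 / p t - 1 / q t) * doubleStar μ f t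

/-- An ergodic flow `(T_τ)_{τ∈ℝ}` of measure preserving transformations on `(X,μ)`. -/
structure ErgodicFlow (X : Type*) [MeasurableSpace X] (μ : Measure X)
    (T : ℝ → X → X) : Prop where
  measurable : Measurable fun p : ℝ × X => T p.1 p.2
  preserving : ∀ τ : ℝ, MeasurePreserving (T τ) μ μ
  map_zero : ∀ x, T 0 x = x
  map_add : ∀ s t x, T (s + t) x = T s (T t x)
  ergodic : ∀ A : Set X, MeasurableSet A → (∀ τ, T τ ⁻¹' A = A) → μ A = 0 ∨ μ Aᶜ = 0

/-- The ergodic maximal function `Mf(x) = sup_{a>0} (1/a)∫₀^a |f(T_τ x)| dτ`. -/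
def ergMax {X : Type*} (T : ℝ → X → X) (f : X → ℝ) (x : X) : ℝ :=
  ⨆ a : {a : ℝ // 0 < a}, (1 / (a : ℝ)) * ∫ τ in Ioo (0 : ℝ) (a : ℝ), |f (T τ x)|

/-- The ergodic Hilbert transform
`Hf(x) = lim_{δ→0+} ∫_{δ ≤ |τ| ≤ 1/δ} f(T_τ x)/τ dτ`. -/
def ergHilbert {X : Type*} (T : ℝ → X → X) (f : X → ℝ) (x : X) : ℝ :=
  limUnder (nhdsWithin (0 : ℝ) (Ioi 0)) fun δ =>
    ∫ τ in {τ : ℝ | δ ≤ |τ| ∧ |τ| ≤ 1 / δ}, f (T τ x) / τ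



/-- two-valued switch at `1` -/
def sw (a b t : ℝ) : ℝ := if t < 1 then a else b

lemma sw_measurable (a b : ℝ) : Measurable (sw a b) :=
  Measurable.ite measurableSet_Iio measurable_const measurable_const

lemma sw_pow_le {a b β s t : ℝ} (ha : a ≤ β) (hb : b ≤ β) (hs : 0 < s) (hst : s ≤ t) :
    t ^ sw a b t ≤ t ^ β * s ^ (-β) * s ^ sw a b s := by
  have ht : 0 < t := hs.trans_le hst
  unfold sw
  have key : ∀ e ≤ β, t ^ e ≤ t ^ β * s ^ (-β) * s ^ e := by
    intro e he
    have h1 : t ^ β * s ^ (-β) * s ^ e = t ^ e * (t / s) ^ (β - e) := by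
      rw [Real.div_rpow ht.le hs.le, div_eq_mul_inv, ← Real.rpow_neg hs.le,
        mul_assoc, ← Real.rpow_add hs, ← mul_assoc, ← Real.rpow_add ht]
      ring_nf
    rw [h1]
    have : 1 ≤ (t / s) ^ (β - e) :=
      Real.one_le_rpow ((one_le_div hs).2 hst) (by linarith)
    nlinarith [Real.rpow_pos_of_pos ht e]
  split_ifs with h1 h2 h3
  · exact key a ha
  · linarith
  · push Not at h1
    have e1 : t ^ b ≤ t ^ β := Real.rpow_le_rpow_of_exponent_le h1 hb
    have e2 : s ^ β ≤ s ^ a := Real.rpow_le_rpow_of_exponent_ge hs h3.le ha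
    have e3 : s ^ (-β) * s ^ β = 1 := by rw [← Real.rpow_add hs]; simp
    calc t ^ b ≤ t ^ β * (s ^ (-β) * s ^ β) := by rw [e3]; simpa using e1
      _ ≤ t ^ β * (s ^ (-β) * s ^ a) := by gcongr
      _ = _ := by ring
  · exact key b hb

lemma rpow_le_exp {t d K : ℝ} (ht : 0 < t) (h : |d| * |Real.log t| ≤ K) : t ^ d ≤ Real.exp K := by
  rw [Real.rpow_def_of_pos ht]
  apply Real.exp_le_exp.2
  rw [← abs_mul] at h
  have := le_abs_self (d * Real.log t)
  linarith

lemma rpow_sw_compare {x : ℝ≥0∞} {t u v K : ℝ} (ht : 0 < t) (hx : x ≤ 1) (hu : 1 ≤ u) (_hv : 1 ≤ v)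
    (h : |u - v| * |Real.log t| ≤ K) :
    x ^ u ≤ ENNReal.ofReal (Real.exp K) * x ^ v + ENNReal.ofReal (min t (t⁻¹)) := by
  have hxt : x ≠ ∞ := (hx.trans_lt ENNReal.one_lt_top).ne
  by_cases hc : x < ENNReal.ofReal (min t t⁻¹)
  · refine le_trans ?_ le_add_self
    refine le_trans ?_ hc.le
    simpa using ENNReal.rpow_le_rpow_of_exponent_ge hx hu
  · refine le_trans ?_ le_self_add
    push Not at hc
    lift x to ℝ≥0 using hxt
    have hm : 0 < min t t⁻¹ := lt_min ht (inv_pos.2 ht)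
    have hx1 : (x : ℝ) ≤ 1 := by exact_mod_cast hx
    have hx2 : min t t⁻¹ ≤ (x : ℝ) := by
      rw [ENNReal.ofReal_le_iff_le_toReal (by simp)] at hc
      simpa using hc
    have hx0 : 0 < (x : ℝ) := hm.trans_le hx2
    have hlog : |Real.log x| ≤ |Real.log t| := by
      rw [abs_of_nonpos (Real.log_nonpos hx0.le hx1)]
      have : Real.log (min t t⁻¹) ≤ Real.log x := Real.log_le_log hm hx2
      have h2 : - |Real.log t| ≤ Real.log (min t t⁻¹) := by
        rcases min_choice t t⁻¹ with h | h <;> rw [h]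
        · exact neg_abs_le _
        · rw [Real.log_inv]; exact neg_le_neg (le_abs_self _)
      linarith
    have h3 : (x : ℝ) ^ (u - v) ≤ Real.exp K :=
      rpow_le_exp hx0 ((mul_le_mul_of_nonneg_left hlog (abs_nonneg _)).trans h)
    have h4 : (x : ℝ) ^ u ≤ Real.exp K * (x : ℝ) ^ v := by
      have : (x : ℝ) ^ u = x ^ (u - v) * x ^ v := by rw [← Real.rpow_add hx0]; ring_nf
      rw [this]; gcongr
    have h5 : (x : ℝ≥0∞) = ENNReal.ofReal (x : ℝ) := by simp
    rw [h5, ENNReal.ofReal_rpow_of_pos hx0, ENNReal.ofReal_rpow_of_pos hx0,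
      ← ENNReal.ofReal_mul (Real.exp_pos _).le]
    exact ENNReal.ofReal_le_ofReal h4

lemma lintegral_rpow_Ioi {a s : ℝ} (ha : a < -1) (hs : 0 < s) :
    ∫⁻ t in Ioi s, ENNReal.ofReal (t ^ a) = ENNReal.ofReal (- s ^ (a + 1) / (a + 1)) := by
  rw [← integral_Ioi_rpow_of_lt ha hs, ofReal_integral_eq_lintegral_ofReal
    (integrableOn_Ioi_rpow_of_lt ha hs)]
  exact (ae_restrict_iff' measurableSet_Ioi).2 (ae_of_all _ fun t ht =>
    Real.rpow_nonneg (hs.le.trans (le_of_lt ht)) _)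

lemma lintegral_rpow_Ioo {r t : ℝ} (hr : -1 < r) (ht : 0 < t) :
    ∫⁻ s in Ioo 0 t, ENNReal.ofReal (s ^ r) = ENNReal.ofReal (t ^ (r + 1) / (r + 1)) := by
  have h1 := integral_rpow (a := 0) (b := t) (r := r) (Or.inl hr)
  rw [Real.zero_rpow (by linarith), sub_zero, intervalIntegral.integral_of_le ht.le,
    integral_Ioc_eq_integral_Ioo] at h1
  rw [← h1, ofReal_integral_eq_lintegral_ofReal]
  · have := (intervalIntegral.intervalIntegrable_rpow' (a := 0) (b := t) hr).1
    exact this.mono_set Ioo_subset_Ioc_self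
  · exact (ae_restrict_iff' measurableSet_Ioo).2 (ae_of_all _ fun t ht =>
      Real.rpow_nonneg ht.1.le _)

lemma lintegral_min : ∫⁻ t in Ioi (0:ℝ), ENNReal.ofReal (min t t⁻¹) * ENNReal.ofReal t⁻¹ < ∞ := by
  have : Ioi (0:ℝ) = Ioo 0 1 ∪ Ici 1 := by
    ext x; simp only [mem_Ioi, mem_union, mem_Ioo, mem_Ici]
    constructor
    · intro h; rcases lt_or_ge x 1 with h' | h' <;> simp [h, h']
    · rintro (h | h) <;> linarith
  rw [this]
  refine (lintegral_union_le _ _ _).trans_lt (ENNReal.add_lt_top.2 ⟨?_, ?_⟩)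
  · calc _ ≤ ∫⁻ t in Ioo (0:ℝ) 1, 1 := by
          refine setLIntegral_mono' measurableSet_Ioo fun t ht => ?_
          rw [← ENNReal.ofReal_mul (le_min ht.1.le (inv_pos.2 ht.1).le), ← ENNReal.ofReal_one]
          apply ENNReal.ofReal_le_ofReal
          calc min t t⁻¹ * t⁻¹ ≤ t * t⁻¹ := by
                gcongr
                · exact (inv_pos.2 ht.1).le
                · exact min_le_left _ _
            _ = 1 := mul_inv_cancel₀ ht.1.ne'
      _ < ∞ := by simp
  · rw [setLIntegral_congr Ioi_ae_eq_Ici.symm]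
    calc _ ≤ ∫⁻ t in Ioi (1:ℝ), ENNReal.ofReal (t ^ (-2:ℝ)) := by
          refine setLIntegral_mono' measurableSet_Ioi fun t ht => ?_
          have ht0 : 0 < t := lt_trans one_pos ht
          rw [← ENNReal.ofReal_mul (le_min ht0.le (inv_pos.2 ht0).le)]
          apply ENNReal.ofReal_le_ofReal
          calc min t t⁻¹ * t⁻¹ ≤ t⁻¹ * t⁻¹ := by
                gcongr
                exact min_le_right _ _
            _ = _ := by rw [Real.rpow_neg ht0.le]; norm_cast; field_simp
      _ < ∞ := by rw [lintegral_rpow_Ioi (by norm_num) one_pos]; simp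

lemma jensen_rpow {α : Type*} [MeasurableSpace α] (ν : Measure α) [IsProbabilityMeasure ν]
    {h : α → ℝ≥0∞} (hh : Measurable h) {r : ℝ} (hr : 1 ≤ r) :
    (∫⁻ a, h a ∂ν) ^ r ≤ ∫⁻ a, h a ^ r ∂ν := by
  have := eLpNorm'_le_eLpNorm'_of_exponent_le one_pos hr ν hh.aestronglyMeasurable
  simp only [eLpNorm', enorm_eq_self, ENNReal.rpow_one, div_one] at this
  have h2 := ENNReal.rpow_le_rpow this (by linarith : 0 ≤ r)
  rwa [← ENNReal.rpow_mul, one_div_mul_cancel (by linarith), ENNReal.rpow_one] at h2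

lemma hardy_bound {q : ℝ → ℝ} (hq1 : ∀ t, 0 < t → 1 ≤ q t) {b0 bi β : ℝ}
    (h0 : b0 ≤ β) (hi : bi ≤ β) (hβ0 : 0 ≤ β) (hβ : β < 1) {F : ℝ → ℝ≥0∞} (hF : Antitone F)
    (hI : ∫⁻ t in Ioi (0:ℝ), (ENNReal.ofReal (t ^ sw b0 bi t) * F t) ^ q t * ENNReal.ofReal t⁻¹ ≤ 1)
    {t : ℝ} (ht : 0 < t) : ENNReal.ofReal (t ^ sw b0 bi t) * F t ≤ 4 := by
  by_contra hcon
  push Not at hcon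
  set x := ENNReal.ofReal (t ^ sw b0 bi t) * F t with hx
  have hpt : ∀ s ∈ Ioc (t/2) t, x / 2 * ENNReal.ofReal t⁻¹ ≤
      (ENNReal.ofReal (s ^ sw b0 bi s) * F s) ^ q s * ENNReal.ofReal s⁻¹ := by
    intro s hs
    have hs0 : 0 < s := by have := hs.1; linarith
    have e1 : t ^ sw b0 bi t ≤ 2 * s ^ sw b0 bi s := by
      refine (sw_pow_le h0 hi hs0 hs.2).trans ?_
      have : t ^ β * s ^ (-β) ≤ 2 := by
        rw [Real.rpow_neg hs0.le, ← div_eq_mul_inv, ← Real.div_rpow ht.le hs0.le]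
        calc (t / s) ^ β ≤ (t / s) ^ (1:ℝ) :=
              Real.rpow_le_rpow_of_exponent_le ((one_le_div hs0).2 hs.2) hβ.le
          _ ≤ 2 := by rw [Real.rpow_one, div_le_iff₀ hs0]; linarith [hs.1]
      have := Real.rpow_nonneg hs0.le (sw b0 bi s)
      gcongr
    have e2 : x ≤ 2 * (ENNReal.ofReal (s ^ sw b0 bi s) * F s) := by
      rw [hx, ← mul_assoc]
      gcongr
      · refine (ENNReal.ofReal_le_ofReal e1).trans ?_
        rw [ENNReal.ofReal_mul (by norm_num)]; simp
      · exact hF hs.2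
    have e3 : x / 2 ≤ ENNReal.ofReal (s ^ sw b0 bi s) * F s := by
      rw [ENNReal.div_le_iff (by norm_num) (by norm_num)]; rwa [mul_comm]
    have e4 : 1 ≤ x / 2 := by
      rw [ENNReal.le_div_iff_mul_le (by norm_num) (by norm_num)]
      refine le_trans ?_ hcon.le
      norm_num
    gcongr
    · calc x / 2 ≤ ENNReal.ofReal (s ^ sw b0 bi s) * F s := e3
        _ = (ENNReal.ofReal (s ^ sw b0 bi s) * F s) ^ (1:ℝ) := by simp
        _ ≤ _ := ENNReal.rpow_le_rpow_of_exponent_le (e4.trans e3) (hq1 s hs0)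
    · exact hs.2
  have h2 : x / 4 ≤ 1 := by
    calc x / 4 = x / 2 * ENNReal.ofReal t⁻¹ * volume (Ioc (t/2) t) := by
          rw [Real.volume_Ioc, mul_assoc, ← ENNReal.ofReal_mul (inv_pos.2 ht).le]
          have : t⁻¹ * (t - t/2) = 2⁻¹ := by field_simp; ring
          have e4 : (4:ℝ≥0∞)⁻¹ = 2⁻¹ * 2⁻¹ := by
            rw [← ENNReal.mul_inv (by simp) (by simp)]; norm_num
          rw [this, ENNReal.ofReal_inv_of_pos (by norm_num), div_eq_mul_inv x, div_eq_mul_inv x, e4,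
            ← mul_assoc x]
          norm_num
      _ = ∫⁻ s in Ioc (t/2) t, x / 2 * ENNReal.ofReal t⁻¹ := by simp
      _ ≤ ∫⁻ s in Ioc (t/2) t, (ENNReal.ofReal (s ^ sw b0 bi s) * F s) ^ q s * ENNReal.ofReal s⁻¹ :=
          setLIntegral_mono' measurableSet_Ioc hpt
      _ ≤ _ := lintegral_mono_set (fun s hs => by
          have := hs.1; simp only [mem_Ioi]; linarith)
      _ ≤ 1 := hI
  rw [ENNReal.div_le_iff (by norm_num) (by norm_num), one_mul] at h2
  exact absurd hcon (not_lt.2 h2)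

/-- Hardy kernel -/
def hk (β t s : ℝ) : ℝ≥0∞ := ENNReal.ofReal ((1 - β) * t ^ (β - 1) * s ^ (-β))

lemma hk_int {β t : ℝ} (hβ : β < 1) (ht : 0 < t) : ∫⁻ s in Ioo 0 t, hk β t s = 1 := by
  unfold hk
  have h1 : 0 ≤ (1 - β) * t ^ (β - 1) := mul_nonneg (by linarith) (Real.rpow_nonneg ht.le _)
  simp_rw [ENNReal.ofReal_mul h1]
  rw [lintegral_const_mul' _ _ (by simp), lintegral_rpow_Ioo (by linarith) ht,
    ← ENNReal.ofReal_mul h1, ← ENNReal.ofReal_one]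
  congr 1
  have : t ^ (β - 1) * t ^ (-β + 1) = 1 := by rw [← Real.rpow_add ht]; simp
  have h3 : 1 - β ≠ 0 := by linarith
  have h4 : -β + 1 = 1 - β := by ring
  rw [h4] at this ⊢
  field_simp
  exact this

lemma hk_int_one {β t : ℝ} (hβ : β < 1) (ht : 1 ≤ t) :
    ∫⁻ s in Ioo 0 1, hk β t s = ENNReal.ofReal (t ^ (β - 1)) := by
  unfold hk
  have ht0 : 0 < t := by linarith
  have h1 : 0 ≤ (1 - β) * t ^ (β - 1) := mul_nonneg (by linarith) (Real.rpow_nonneg ht0.le _)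
  simp_rw [ENNReal.ofReal_mul h1]
  rw [lintegral_const_mul' _ _ (by simp), lintegral_rpow_Ioo (by linarith) one_pos,
    ← ENNReal.ofReal_mul h1]
  congr 1
  have h3 : 1 - β ≠ 0 := by linarith
  have h4 : -β + 1 = 1 - β := by ring
  rw [h4, Real.one_rpow]
  field_simp

lemma hk_int_t {β s : ℝ} (hβ : β < 1) (hs : 0 < s) :
    ∫⁻ t in Ioi s, hk β t s * ENNReal.ofReal t⁻¹ = ENNReal.ofReal s⁻¹ := by
  unfold hk
  have h1 : 0 ≤ (1 - β) * s ^ (-β) := mul_nonneg (by linarith) (Real.rpow_nonneg hs.le _)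
  have : ∀ t ∈ Ioi s, ENNReal.ofReal ((1 - β) * t ^ (β - 1) * s ^ (-β)) * ENNReal.ofReal t⁻¹ =
      ENNReal.ofReal ((1 - β) * s ^ (-β)) * ENNReal.ofReal (t ^ (β - 2)) := by
    intro t ht
    have ht0 : 0 < t := hs.trans ht
    rw [← ENNReal.ofReal_mul h1, ← ENNReal.ofReal_mul (by
      have := Real.rpow_nonneg ht0.le (β - 1); have := Real.rpow_nonneg hs.le (-β)
      have : 0 ≤ 1 - β := by linarith
      positivity)]
    congr 1
    have : t ^ (β - 2) = t ^ (β - 1) * t⁻¹ := by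
      rw [← Real.rpow_neg_one, ← Real.rpow_add ht0]; ring_nf
    rw [this]; ring
  rw [setLIntegral_congr_fun measurableSet_Ioi this, lintegral_const_mul' _ _ (by simp),
    lintegral_rpow_Ioi (by linarith) hs, ← ENNReal.ofReal_mul h1]
  congr 1
  have : s ^ (-β) * s ^ (β - 2 + 1) = s⁻¹ := by
    rw [← Real.rpow_add hs, ← Real.rpow_neg_one]; ring_nf
  have h4 : β - 2 + 1 = - (1 - β) := by ring
  have h3 : 1 - β ≠ 0 := by linarith
  rw [h4] at this ⊢
  rw [neg_div_neg_eq]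
  rw [← this]
  field_simp

lemma hk_meas (β : ℝ) : Measurable (Function.uncurry (hk β)) := by
  unfold hk Function.uncurry
  fun_prop

lemma hardy {q : ℝ → ℝ} (hqm : Measurable q) (hq1 : ∀ t, 0 < t → 1 ≤ q t) {q0 qi : ℝ}
    (hq0 : 1 ≤ q0) (hqi : 1 ≤ qi) {K : ℝ}
    (hK : ∀ t, 0 < t → |q t - sw q0 qi t| * |Real.log t| ≤ K) {b0 bi β : ℝ}
    (h0 : b0 ≤ β) (hi : bi ≤ β) (hβ0 : 0 ≤ β) (hβ : β < 1) :
    ∃ C : ℝ≥0∞, 1 ≤ C ∧ C < ∞ ∧ ∀ F : ℝ → ℝ≥0∞, Antitone F →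
    ∫⁻ t in Ioi (0:ℝ), (ENNReal.ofReal (t ^ sw b0 bi t) * F t) ^ q t * ENNReal.ofReal t⁻¹ ≤ 1 →
    ∫⁻ t in Ioi (0:ℝ), (ENNReal.ofReal (t ^ sw b0 bi t) *
      (ENNReal.ofReal t⁻¹ * ∫⁻ s in Ioo 0 t, F s) / C) ^ q t * ENNReal.ofReal t⁻¹ ≤ 1 := by
  set EK := ENNReal.ofReal (Real.exp K) with hEK
  set R := ∫⁻ t in Ioi (0:ℝ), ENNReal.ofReal (min t t⁻¹) * ENNReal.ofReal t⁻¹ with hR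
  have hRt : R < ∞ := lintegral_min
  have hsw1 : ∀ t, 1 ≤ sw q0 qi t := fun t => by unfold sw; split_ifs <;> assumption
  set B := ENNReal.ofReal (1 - β) with hB
  have hB0 : B ≠ 0 := by rw [hB]; simp; linarith
  have hBt : B ≠ ∞ := by simp [hB]
  set D := EK * (EK * 1 + R + ENNReal.ofReal ((1-β)⁻¹)) + R + 1 with hD
  have hD1 : 1 ≤ D := le_add_self
  have hDt : D ≠ ∞ := by
    simp only [hD, hEK]
    finiteness
  refine ⟨4 * B⁻¹ * D, ?_, ?_, ?_⟩
  · have : 1 ≤ B⁻¹ := by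
      rw [ENNReal.one_le_inv, hB, ENNReal.ofReal_le_one]; linarith
    calc (1:ℝ≥0∞) = 1 * 1 * 1 := by simp
      _ ≤ _ := by gcongr; norm_num
  · have : B⁻¹ ≠ ∞ := by simp [hB0]
    exact lt_top_iff_ne_top.2 (by finiteness)
  intro F hF hI
  -- normalized function
  set U : ℝ → ℝ≥0∞ := fun t => ENNReal.ofReal (t ^ sw b0 bi t) with hU
  have hUm : Measurable U := by
    have := sw_measurable b0 bi
    exact (measurable_id.pow this).ennreal_ofReal
  have hFm : Measurable F := hF.measurable
  set h : ℝ → ℝ≥0∞ := fun t => U t * F t / 4 with hh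
  have hhm : Measurable h := (hUm.mul hFm).div_const _
  have hh1 : ∀ t, 0 < t → h t ≤ 1 := by
    intro t ht
    rw [hh]; simp only
    rw [ENNReal.div_le_iff (by norm_num) (by norm_num), one_mul]
    exact hardy_bound hq1 h0 hi hβ0 hβ hF hI ht
  have hqs : Measurable (sw q0 qi) := sw_measurable _ _
  have hIh : ∫⁻ t in Ioi (0:ℝ), h t ^ sw q0 qi t * ENNReal.ofReal t⁻¹ ≤ EK * 1 + R := by
    calc _ ≤ ∫⁻ t in Ioi (0:ℝ), (EK * ((U t * F t) ^ q t * ENNReal.ofReal t⁻¹) +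
          ENNReal.ofReal (min t t⁻¹) * ENNReal.ofReal t⁻¹) := by
          refine setLIntegral_mono' measurableSet_Ioi fun t ht => ?_
          rw [← mul_assoc, ← add_mul]
          gcongr
          have := rpow_sw_compare (u := sw q0 qi t) (v := q t) (K := K) ht (hh1 t ht) (hsw1 t)
            (hq1 t ht) (by rw [abs_sub_comm]; exact hK t ht)
          refine this.trans ?_
          gcongr
          · linarith [hq1 t ht]
          · exact ENNReal.div_le_of_le_mul (le_mul_of_one_le_right (zero_le) (by norm_num))
      _ = EK * (∫⁻ t in Ioi (0:ℝ), ((U t * F t) ^ q t * ENNReal.ofReal t⁻¹)) + R := by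
          rw [lintegral_add_right _ (by fun_prop), lintegral_const_mul' _ _ (by simp [hEK])]
      _ ≤ _ := by gcongr
  -- the averaged function
  set H : ℝ → ℝ≥0∞ := fun t => ∫⁻ s in Ioo 0 t, hk β t s * h s with hH
  have hH1 : ∀ t, 0 < t → H t ≤ 1 := by
    intro t ht
    rw [← hk_int hβ ht]
    refine setLIntegral_mono' measurableSet_Ioo fun s hs => ?_
    exact mul_le_of_le_one_right (zero_le) (hh1 s hs.1)
  have hUH : ∀ t, 0 < t → U t * (ENNReal.ofReal t⁻¹ * ∫⁻ s in Ioo 0 t, F s) * B / 4 ≤ H t := by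
    intro t ht
    have : U t * (ENNReal.ofReal t⁻¹ * ∫⁻ s in Ioo 0 t, F s) * B / 4 =
        ∫⁻ s in Ioo 0 t, (U t * ENNReal.ofReal t⁻¹ * B / 4) * F s := by
      rw [lintegral_const_mul _ hFm]
      simp only [div_eq_mul_inv]; ring
    rw [this]
    refine setLIntegral_mono' measurableSet_Ioo fun s hs => ?_
    have e : U t * ENNReal.ofReal t⁻¹ * B ≤ hk β t s * U s := by
      simp only [hU, hB, hk]
      have hb : 0 ≤ 1 - β := by linarith
      have := hs.1
      rw [← ENNReal.ofReal_mul (by positivity), ← ENNReal.ofReal_mul (by positivity),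
        ← ENNReal.ofReal_mul (by positivity)]
      apply ENNReal.ofReal_le_ofReal
      have e1 := sw_pow_le h0 hi hs.1 hs.2.le
      have e2 : t ^ (β - 1) = t ^ β * t⁻¹ := by rw [Real.rpow_sub ht, Real.rpow_one]; rfl
      calc _ ≤ (t ^ β * s ^ (-β) * s ^ sw b0 bi s) * t⁻¹ * (1 - β) := by gcongr
        _ = _ := by rw [e2]; ring
    calc _ = (U t * ENNReal.ofReal t⁻¹ * B) * (F s / 4) := by simp only [div_eq_mul_inv]; ring
      _ ≤ (hk β t s * U s) * (F s / 4) := by gcongr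
      _ = _ := by simp only [hh, div_eq_mul_inv]; ring
  -- Jensen
  have hJ : ∀ t, 0 < t → H t ^ sw q0 qi t ≤ (∫⁻ s in Ioo 0 t, hk β t s * h s ^ sw q0 qi s) +
      (if 1 < t then ENNReal.ofReal (t ^ (β - 1)) else 0) + (if t = 1 then ∞ else 0) := by
    intro t ht
    have hkm : Measurable (hk β t) := (hk_meas β).of_uncurry_left
    let ν := (volume.restrict (Ioo 0 t)).withDensity (hk β t)
    have hν : IsProbabilityMeasure ν := ⟨by
      simp only [ν]; rw [withDensity_apply _ MeasurableSet.univ, Measure.restrict_univ, hk_int hβ ht]⟩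
    have j := jensen_rpow ν hhm (hsw1 t)
    have hhm2 : Measurable fun s => h s ^ sw q0 qi t := hhm.pow_const _
    rw [lintegral_withDensity_eq_lintegral_mul _ hkm hhm,
      lintegral_withDensity_eq_lintegral_mul _ hkm hhm2] at j
    simp only [Pi.mul_apply] at j
    refine j.trans ?_
    rcases lt_trichotomy t 1 with h1 | h1 | h1
    · refine le_trans ?_ (le_self_add.trans le_self_add)
      refine setLIntegral_mono' measurableSet_Ioo fun s hs => ?_
      have : sw q0 qi t = sw q0 qi s := by unfold sw; rw [if_pos h1, if_pos (hs.2.trans h1)]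
      rw [this]
    · simp [h1]
    · refine le_trans ?_ le_self_add
      rw [if_pos h1, ← hk_int_one hβ h1.le]
      have hsub : Ioo (0:ℝ) 1 ⊆ Ioo 0 t := Ioo_subset_Ioo_right h1.le
      have : ∫⁻ s in Ioo 0 1, hk β t s = ∫⁻ s in Ioo 0 t, (Ioo 0 1).indicator (hk β t) s := by
        rw [setLIntegral_indicator measurableSet_Ioo, inter_eq_left.2 hsub]
      rw [this, ← lintegral_add_right _ (hkm.indicator measurableSet_Ioo)]
      refine setLIntegral_mono' measurableSet_Ioo fun s hs => ?_
      by_cases hs1 : s < 1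
      · refine le_trans ?_ le_add_self
        have hmem : s ∈ Ioo (0:ℝ) 1 := ⟨hs.1, hs1⟩
        rw [indicator_of_mem hmem]
        refine mul_le_of_le_one_right (zero_le) ?_
        exact ENNReal.rpow_le_one (hh1 s hs.1) (by linarith [hsw1 t])
      · refine le_trans ?_ le_self_add
        have : sw q0 qi t = sw q0 qi s := by unfold sw; rw [if_neg hs1, if_neg (not_lt.2 h1.le)]
        rw [this]
  have hswap : ∫⁻ t in Ioi (0:ℝ), (∫⁻ s in Ioo 0 t, hk β t s * h s ^ sw q0 qi s) *
      ENNReal.ofReal t⁻¹ = ∫⁻ t in Ioi (0:ℝ), h t ^ sw q0 qi t * ENNReal.ofReal t⁻¹ := by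
    have e1 : ∀ t ∈ Ioi (0:ℝ), (∫⁻ s in Ioo 0 t, hk β t s * h s ^ sw q0 qi s) *
      ENNReal.ofReal t⁻¹ = ∫⁻ s in Ioi (0:ℝ), {x : ℝ × ℝ | x.2 < x.1}.indicator
        (fun x => hk β x.1 x.2 * ENNReal.ofReal x.1⁻¹ * h x.2 ^ sw q0 qi x.2) (t, s) := by
      intro t ht
      rw [← lintegral_mul_const' _ _ (by simp)]
      have : Ioo 0 t = Ioi 0 ∩ Iio t := rfl
      rw [this, inter_comm, ← setLIntegral_indicator measurableSet_Iio]
      refine lintegral_congr fun s => ?_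
      by_cases hst : s < t
      · rw [indicator_of_mem (by exact hst), indicator_of_mem (by exact hst)]; ring
      · rw [indicator_of_notMem (by exact hst), indicator_of_notMem (by exact hst)]
    rw [setLIntegral_congr_fun measurableSet_Ioi e1, lintegral_lintegral_swap]
    · refine setLIntegral_congr_fun measurableSet_Ioi fun s hs => ?_
      calc _ = ∫⁻ t in Ioi 0, (Ioi s).indicator (fun t => h s ^ sw q0 qi s *
              (hk β t s * ENNReal.ofReal t⁻¹)) t := by
            refine lintegral_congr fun t => ?_
            by_cases hst : s < t
            · rw [indicator_of_mem (by exact hst), indicator_of_mem (by exact hst)]; ring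
            · rw [indicator_of_notMem (by exact hst), indicator_of_notMem (by exact hst)]
        _ = ∫⁻ t in Ioi s, h s ^ sw q0 qi s * (hk β t s * ENNReal.ofReal t⁻¹) := by
            rw [setLIntegral_indicator measurableSet_Ioi, inter_eq_left.2 (Ioi_subset_Ioi (le_of_lt hs))]
        _ = h s ^ sw q0 qi s * ENNReal.ofReal s⁻¹ := by
            have hkm : Measurable fun t => hk β t s := (hk_meas β).of_uncurry_right
            rw [lintegral_const_mul _ (by fun_prop), hk_int_t hβ hs]
    · apply Measurable.aemeasurable
      have := hk_meas β
      refine Measurable.indicator ?_ (measurableSet_lt measurable_snd measurable_fst)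
      have e : Measurable fun x : ℝ × ℝ => h x.2 ^ sw q0 qi x.2 :=
        (hhm.pow hqs).comp measurable_snd
      exact (this.mul (measurable_fst.inv.ennreal_ofReal)).mul e
  have hIH : ∫⁻ t in Ioi (0:ℝ), H t ^ sw q0 qi t * ENNReal.ofReal t⁻¹ ≤
      EK * 1 + R + ENNReal.ofReal ((1-β)⁻¹) := by
    calc _ ≤ ∫⁻ t in Ioi (0:ℝ), ((∫⁻ s in Ioo 0 t, hk β t s * h s ^ sw q0 qi s) *
          ENNReal.ofReal t⁻¹ + (Ioi 1).indicator (fun t => ENNReal.ofReal (t ^ (β - 2))) t) := by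
          refine lintegral_mono_ae ?_
          have hne : ∀ᵐ t ∂(volume.restrict (Ioi (0:ℝ))), t ≠ 1 :=
            ae_restrict_of_ae (by simp [ae_iff, measure_singleton])
          filter_upwards [hne, ae_restrict_mem measurableSet_Ioi] with t ht1 ht
          have := hJ t ht
          rw [if_neg ht1, add_zero] at this
          refine (mul_le_mul_left this _).trans ?_
          rw [add_mul]
          gcongr
          split_ifs with h1
          · rw [indicator_of_mem (by exact h1), ← ENNReal.ofReal_mul (Real.rpow_nonneg (le_of_lt ht) _)]
            apply ENNReal.ofReal_le_ofReal
            rw [← Real.rpow_neg_one, ← Real.rpow_add ht]; ring_nf; rfl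
          · simp
      _ = (∫⁻ t in Ioi (0:ℝ), h t ^ sw q0 qi t * ENNReal.ofReal t⁻¹) +
            ENNReal.ofReal ((1-β)⁻¹) := by
          rw [lintegral_add_right _ (Measurable.indicator (by fun_prop) measurableSet_Ioi), hswap,
            setLIntegral_indicator measurableSet_Ioi, inter_eq_left.2 (Ioi_subset_Ioi zero_le_one),
            lintegral_rpow_Ioi (by linarith) one_pos]
          congr 2
          have h4 : β - 2 + 1 = - (1 - β) := by ring
          rw [h4, neg_div_neg_eq]; simp
      _ ≤ _ := by gcongr
  have hfin : ∫⁻ t in Ioi (0:ℝ), H t ^ q t * ENNReal.ofReal t⁻¹ ≤ D := by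
    calc _ ≤ ∫⁻ t in Ioi (0:ℝ), (EK * (H t ^ sw q0 qi t * ENNReal.ofReal t⁻¹) +
          ENNReal.ofReal (min t t⁻¹) * ENNReal.ofReal t⁻¹) := by
          refine setLIntegral_mono' measurableSet_Ioi fun t ht => ?_
          rw [← mul_assoc, ← add_mul]
          gcongr
          exact rpow_sw_compare ht (hH1 t ht) (hq1 t ht) (hsw1 t) (hK t ht)
      _ = EK * (∫⁻ t in Ioi (0:ℝ), (H t ^ sw q0 qi t * ENNReal.ofReal t⁻¹)) + R := by
          rw [lintegral_add_right _ (by fun_prop), lintegral_const_mul' _ _ (by simp [hEK])]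
      _ ≤ EK * (EK * 1 + R + ENNReal.ofReal ((1-β)⁻¹)) + R := by gcongr
      _ ≤ _ := le_self_add
  calc _ ≤ ∫⁻ t in Ioi (0:ℝ), D⁻¹ * (H t ^ q t * ENNReal.ofReal t⁻¹) := by
        refine setLIntegral_mono' measurableSet_Ioi fun t ht => ?_
        rw [← mul_assoc D⁻¹]
        refine mul_le_mul_left ?_ _
        have e : U t * (ENNReal.ofReal t⁻¹ * ∫⁻ s in Ioo 0 t, F s) / (4 * B⁻¹ * D) ≤ H t * D⁻¹ := by
          have : U t * (ENNReal.ofReal t⁻¹ * ∫⁻ s in Ioo 0 t, F s) / (4 * B⁻¹ * D) =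
            U t * (ENNReal.ofReal t⁻¹ * ∫⁻ s in Ioo 0 t, F s) * B / 4 * D⁻¹ := by
            rw [div_eq_mul_inv, ENNReal.mul_inv (by right; exact hDt) (by left; finiteness),
              ENNReal.mul_inv (by simp) (by simp), inv_inv]
            simp only [div_eq_mul_inv]; ring
          rw [this]
          gcongr
          exact hUH t ht
        calc _ ≤ (H t * D⁻¹) ^ q t := ENNReal.rpow_le_rpow e (by linarith [hq1 t ht])
          _ = H t ^ q t * D⁻¹ ^ q t := ENNReal.mul_rpow_of_nonneg _ _ (by linarith [hq1 t ht])
          _ ≤ H t ^ q t * D⁻¹ ^ (1:ℝ) := by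
            refine mul_le_mul_right ?_ _
            exact ENNReal.rpow_le_rpow_of_exponent_ge (ENNReal.inv_le_one.2 hD1) (hq1 t ht)
          _ = _ := by rw [ENNReal.rpow_one, mul_comm]
    _ = D⁻¹ * ∫⁻ t in Ioi (0:ℝ), (H t ^ q t * ENNReal.ofReal t⁻¹) := by
        rw [lintegral_const_mul' _ _ (by simp; positivity)]
    _ ≤ D⁻¹ * D := by gcongr
    _ ≤ 1 := ENNReal.inv_mul_le_one D

/-- centered Hardy–Littlewood maximal function -/
def mx {n : ℕ} (g : EuclideanSpace ℝ (Fin n) → ℝ≥0∞) (x : EuclideanSpace ℝ (Fin n)) : ℝ≥0∞ :=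
  ⨆ r : {r : ℝ // 0 < r}, (∫⁻ y in closedBall x (r : ℝ), g y) / volume (closedBall x (r : ℝ))

lemma vol_cb {n : ℕ} (x : EuclideanSpace ℝ (Fin n)) {r : ℝ} (hr : 0 ≤ r) :
    volume (closedBall x r) = ENNReal.ofReal (r ^ n) *
      volume (ball (0 : EuclideanSpace ℝ (Fin n)) 1) := by
  rw [Measure.addHaar_closedBall _ _ hr]; simp

lemma om_ne_zero {n : ℕ} : volume (ball (0 : EuclideanSpace ℝ (Fin n)) 1) ≠ 0 :=
  (measure_ball_pos _ _ one_pos).ne'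

lemma om_ne_top {n : ℕ} : volume (ball (0 : EuclideanSpace ℝ (Fin n)) 1) ≠ ∞ :=
  measure_ball_lt_top.ne

lemma mx_ball {n : ℕ} (g : EuclideanSpace ℝ (Fin n) → ℝ≥0∞) (x : EuclideanSpace ℝ (Fin n)) {r : ℝ}
    (hr : 0 < r) : ∫⁻ y in closedBall x r, g y ≤ volume (closedBall x r) * mx g x := by
  have : (∫⁻ y in closedBall x r, g y) / volume (closedBall x r) ≤ mx g x :=
    le_iSup (fun r : {r : ℝ // 0 < r} =>
      (∫⁻ y in closedBall x (r : ℝ), g y) / volume (closedBall x (r : ℝ))) ⟨r, hr⟩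
  rw [ENNReal.div_le_iff (measure_closedBall_pos _ _ hr).ne' measure_closedBall_lt_top.ne] at this
  rwa [mul_comm]

lemma mx_weak {n : ℕ} (hn : 0 < n) (g : EuclideanSpace ℝ (Fin n) → ℝ≥0∞)
    (σ : ℝ≥0∞) : σ * volume {x | σ < mx g x} ≤ 4 ^ n * ∫⁻ x, g x := by
  by_cases hσ0 : σ = 0
  · simp [hσ0]
  by_cases hσt : σ = ∞
  · simp [hσt]
  by_cases hI : ∫⁻ x, g x = ∞
  · rw [hI, ENNReal.mul_top (by positivity)]; exact le_top
  set S := {x | σ < mx g x} with hS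
  have hex : ∀ x : EuclideanSpace ℝ (Fin n), ∃ r : ℝ, x ∈ S → 0 < r ∧
      σ * volume (closedBall x r) < ∫⁻ y in closedBall x r, g y := by
    intro x
    by_cases hx : x ∈ S
    · obtain ⟨r, hr⟩ := lt_iSup_iff.1 (show σ < ⨆ r : {r : ℝ // 0 < r}, (∫⁻ y in closedBall x (r : ℝ), g y) /
        volume (closedBall x (r : ℝ)) from hx)
      refine ⟨r, fun _ => ⟨r.2, ?_⟩⟩
      rwa [ENNReal.lt_div_iff_mul_lt (Or.inl (measure_closedBall_pos _ _ r.2).ne')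
        (Or.inl measure_closedBall_lt_top.ne)] at hr
    · exact ⟨0, fun h => absurd h hx⟩
  choose r hr using hex
  set ω := volume (ball (0 : EuclideanSpace ℝ (Fin n)) 1) with hω
  set A := ((∫⁻ x, g x) / σ / ω).toReal with hA
  have hAt : (∫⁻ x, g x) / σ / ω ≠ ∞ := by
    have h1 := om_ne_zero (n := n)
    exact ENNReal.div_ne_top (ENNReal.div_ne_top hI hσ0) h1
  have hR : ∀ x ∈ S, r x ≤ max 1 A := by
    intro x hx
    obtain ⟨h1, h2⟩ := hr x hx
    have h3 : σ * (ENNReal.ofReal (r x ^ n) * ω) ≤ ∫⁻ x, g x := by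
      rw [hω, ← vol_cb x h1.le]
      exact h2.le.trans (setLIntegral_le_lintegral _ _)
    have h4 : ENNReal.ofReal (r x ^ n) ≤ (∫⁻ x, g x) / σ / ω := by
      rw [ENNReal.le_div_iff_mul_le (Or.inl om_ne_zero) (Or.inl om_ne_top),
        ENNReal.le_div_iff_mul_le (Or.inl hσ0) (Or.inl hσt)]
      rwa [mul_comm]
    have h5 : r x ^ n ≤ A := (ENNReal.ofReal_le_iff_le_toReal hAt).1 h4
    rcases le_total (r x) 1 with h | h
    · exact h.trans (le_max_left _ _)
    · exact (le_self_pow₀ h hn.ne').trans (h5.trans (le_max_right _ _))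
  obtain ⟨u, huS, hdisj, hcov⟩ := Vitali.exists_disjoint_subfamily_covering_enlargement_closedBall
    S id r (max 1 A) hR 4 (by norm_num)
  simp only [id] at hdisj hcov
  have hcount : u.Countable := by
    refine hdisj.countable_of_nonempty_interior fun x hx => ?_
    rw [interior_closedBall _ (hr x (huS hx)).1.ne']
    exact nonempty_ball.2 (hr x (huS hx)).1
  have hsub : S ⊆ ⋃ b ∈ u, closedBall b (4 * r b) := by
    intro x hx
    obtain ⟨b, hb, hb2⟩ := hcov x hx
    exact mem_biUnion hb (hb2 (mem_closedBall_self (hr x hx).1.le))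
  calc σ * volume S ≤ σ * ∑' b : u, volume (closedBall (b : EuclideanSpace ℝ (Fin n)) (4 * r b)) := by
        gcongr
        exact (measure_mono hsub).trans (measure_biUnion_le _ hcount _)
    _ = ∑' b : u, 4 ^ n * (σ * volume (closedBall (b : EuclideanSpace ℝ (Fin n)) (r b))) := by
        rw [← ENNReal.tsum_mul_left]
        refine tsum_congr fun b => ?_
        have hb := (hr b (huS b.2)).1
        rw [vol_cb _ hb.le, vol_cb _ (by linarith), mul_pow, ENNReal.ofReal_mul (by positivity)]
        have : ENNReal.ofReal ((4:ℝ) ^ n) = 4 ^ n := by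
          rw [ENNReal.ofReal_pow (by norm_num)]; norm_num
        rw [this]; ring
    _ ≤ ∑' b : u, 4 ^ n * ∫⁻ y in closedBall (b : EuclideanSpace ℝ (Fin n)) (r b), g y := by
        refine ENNReal.tsum_le_tsum fun b => ?_
        gcongr
        exact (hr b (huS b.2)).2.le
    _ = 4 ^ n * ∫⁻ y in ⋃ b ∈ u, closedBall (b : EuclideanSpace ℝ (Fin n)) (r b), g y := by
        rw [ENNReal.tsum_mul_left, lintegral_biUnion hcount (fun _ _ => measurableSet_closedBall) hdisj]
    _ ≤ _ := by gcongr; exact Measure.restrict_le_self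

/-- unnormalized Poisson kernel -/
def pk (n : ℕ) (y : ℝ) (v : EuclideanSpace ℝ (Fin n)) : ℝ :=
  y * ((‖v‖ ^ 2 + y ^ 2) ^ (-(((n : ℝ) + 1) / 2)))

lemma pk_pow_le {n : ℕ} {ρ A : ℝ} (hρ : 0 < ρ) (h : ρ ^ 2 ≤ A) :
    A ^ (-(((n : ℝ) + 1) / 2)) ≤ (ρ ^ (n + 1))⁻¹ := by
  calc A ^ (-(((n : ℝ) + 1) / 2)) ≤ (ρ ^ 2) ^ (-(((n : ℝ) + 1) / 2)) :=
        Real.rpow_le_rpow_of_nonpos (by positivity) h (by have : (0:ℝ) ≤ n := by positivity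
                                                          linarith)
    _ = _ := by
        rw [← Real.rpow_natCast, ← Real.rpow_mul hρ.le, ← Real.rpow_natCast, ← Real.rpow_neg hρ.le]
        push_cast; ring_nf

lemma pk_nonneg {n : ℕ} {y : ℝ} (hy : 0 < y) (v : EuclideanSpace ℝ (Fin n)) : 0 ≤ pk n y v := by
  unfold pk; positivity

lemma pk_pos {n : ℕ} {y : ℝ} (hy : 0 < y) (v : EuclideanSpace ℝ (Fin n)) : 0 < pk n y v := by
  unfold pk; positivity

/-- dyadic coefficients -/
def dc (n : ℕ) (y : ℝ) (j : ℕ) : ℝ := 2 ^ (n + 1) * (((2 : ℝ) ^ j) ^ (n + 1) * y ^ n)⁻¹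

lemma pk_dyadic {n : ℕ} {y : ℝ} (hy : 0 < y) (x ξ : EuclideanSpace ℝ (Fin n)) :
    ENNReal.ofReal (pk n y (x - ξ)) ≤
      ∑' j : ℕ, (closedBall x (2 ^ j * y)).indicator (fun _ => ENNReal.ofReal (dc n y j)) ξ := by
  have hex : ∃ j : ℕ, ‖x - ξ‖ ≤ 2 ^ j * y := by
    obtain ⟨j, hj⟩ := pow_unbounded_of_one_lt (‖x - ξ‖ / y) (one_lt_two)
    exact ⟨j, ((div_lt_iff₀ hy).1 hj).le⟩
  classical
  have h1 := Nat.find_spec hex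
  have h2 := fun m => Nat.find_min hex (m := m)
  set j := Nat.find hex with hj
  refine le_trans ?_ (ENNReal.le_tsum j)
  rw [indicator_of_mem (by rw [mem_closedBall, dist_comm, dist_eq_norm]; exact h1)]
  apply ENNReal.ofReal_le_ofReal
  unfold pk dc
  rcases Nat.eq_zero_or_pos j with h0 | h0
  · rw [h0]
    have := pk_pow_le (n := n) (ρ := y) (A := ‖x - ξ‖ ^ 2 + y ^ 2) hy (by nlinarith [sq_nonneg ‖x - ξ‖])
    calc _ ≤ y * (y ^ (n + 1))⁻¹ := by gcongr
      _ = 1 * (y ^ n)⁻¹ := by rw [pow_succ]; field_simp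
      _ ≤ _ := by
        simp only [pow_zero, one_pow, one_mul]
        have : (1:ℝ) ≤ 2 ^ (n+1) := one_le_pow₀ (by norm_num)
        have h3 : 0 ≤ (y ^ n)⁻¹ := by positivity
        nlinarith
  · obtain ⟨i, hi⟩ := Nat.exists_eq_succ_of_ne_zero h0.ne'
    have h3 := h2 i (by omega)
    push Not at h3
    have hp : 0 < 2 ^ i * y := by positivity
    have := pk_pow_le (n := n) (ρ := 2 ^ i * y) (A := ‖x - ξ‖ ^ 2 + y ^ 2) hp (by nlinarith)
    calc _ ≤ y * ((2 ^ i * y) ^ (n + 1))⁻¹ := by gcongr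
      _ = _ := by
        rw [hi, pow_succ (2:ℝ) i, mul_pow, mul_pow, pow_succ y]
        field_simp

lemma poisson_le_mx {n : ℕ} {y : ℝ} (hy : 0 < y) {g : EuclideanSpace ℝ (Fin n) → ℝ≥0∞}
    (hg : Measurable g) (x : EuclideanSpace ℝ (Fin n)) :
    ∫⁻ ξ, ENNReal.ofReal (pk n y (x - ξ)) * g ξ ≤
      2 ^ (n + 2) * volume (ball (0 : EuclideanSpace ℝ (Fin n)) 1) * mx g x := by
  calc _ ≤ ∫⁻ ξ, ∑' j : ℕ, (closedBall x (2 ^ j * y)).indicator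
          (fun ξ => ENNReal.ofReal (dc n y j) * g ξ) ξ := by
        refine lintegral_mono fun ξ => ?_
        refine (mul_le_mul_left (pk_dyadic hy x ξ) _).trans ?_
        rw [← ENNReal.tsum_mul_right]
        refine ENNReal.tsum_le_tsum fun j => ?_
        by_cases h : ξ ∈ closedBall x (2 ^ j * y)
        · rw [indicator_of_mem h, indicator_of_mem h]
        · rw [indicator_of_notMem h, indicator_of_notMem h]; simp
    _ = ∑' j : ℕ, ENNReal.ofReal (dc n y j) * ∫⁻ ξ in closedBall x (2 ^ j * y), g ξ := by
        rw [lintegral_tsum]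
        · refine tsum_congr fun j => ?_
          rw [lintegral_indicator measurableSet_closedBall, lintegral_const_mul _ hg]
        · intro j
          exact ((hg.const_mul _).indicator measurableSet_closedBall).aemeasurable
    _ ≤ ∑' j : ℕ, ENNReal.ofReal (dc n y j) * (volume (closedBall x (2 ^ j * y)) * mx g x) := by
        refine ENNReal.tsum_le_tsum fun j => ?_
        gcongr
        exact mx_ball g x (by positivity)
    _ = ∑' j : ℕ, (2:ℝ≥0∞)⁻¹ ^ j * (2 ^ (n + 1) *
          volume (ball (0 : EuclideanSpace ℝ (Fin n)) 1) * mx g x) := by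
        refine tsum_congr fun j => ?_
        rw [vol_cb _ (by positivity), ← mul_assoc, ← mul_assoc, ← ENNReal.ofReal_mul
          (by unfold dc; positivity)]
        have : dc n y j * (2 ^ j * y) ^ n = (2⁻¹) ^ j * 2 ^ (n + 1) := by
          unfold dc
          rw [mul_pow, pow_succ ((2:ℝ) ^ j), inv_pow]
          field_simp
        rw [this, ENNReal.ofReal_mul (by positivity), ENNReal.ofReal_pow (by positivity),
          ENNReal.ofReal_pow (by positivity), ENNReal.ofReal_inv_of_pos (by norm_num)]
        norm_num
        ring
    _ = _ := by
        rw [ENNReal.tsum_mul_right, ENNReal.tsum_geometric]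
        have : (1 - (2:ℝ≥0∞)⁻¹)⁻¹ = 2 := by rw [ENNReal.one_sub_inv_two, inv_inv]
        rw [this]; ring

/-- extended valued rearrangement -/
def FF {α : Type*} [MeasurableSpace α] (μ : Measure α) (f : α → ℝ) (t : ℝ) : ℝ≥0∞ :=
  ⨆ (s : ℝ≥0) (_ : ENNReal.ofReal t < μ {x | (s : ℝ) < |f x|}), (s : ℝ≥0∞)

lemma FF_antitone {α : Type*} [MeasurableSpace α] (μ : Measure α) (f : α → ℝ) :
    Antitone (FF μ f) := by
  intro a b hab
  refine iSup₂_le fun s hs => ?_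
  exact le_iSup₂_of_le s ((ENNReal.ofReal_le_ofReal hab).trans_lt hs) le_rfl

lemma le_FF {α : Type*} [MeasurableSpace α] {μ : Measure α} {f : α → ℝ} {t s : ℝ} (hs : 0 ≤ s)
    (h : ENNReal.ofReal t < μ {x | s < |f x|}) : ENNReal.ofReal s ≤ FF μ f t := by
  have : ENNReal.ofReal s = ((s.toNNReal : ℝ≥0) : ℝ≥0∞) := rfl
  rw [this]
  unfold FF
  refine le_iSup₂_of_le (f := fun (s : ℝ≥0) (_ : ENNReal.ofReal t < μ {x | (s : ℝ) < |f x|}) =>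
    (s : ℝ≥0∞)) s.toNNReal ?_ le_rfl
  rwa [Real.coe_toNNReal _ hs]

lemma dist_small {α : Type*} [MeasurableSpace α] {μ : Measure α} {f : α → ℝ} (hf : Measurable f)
    {s0 : ℝ} (h0 : μ {x | s0 < |f x|} ≠ ∞) {t : ℝ} (ht : 0 < t) :
    ∃ s1 : ℝ, 0 ≤ s1 ∧ μ {x | s1 < |f x|} ≤ ENNReal.ofReal t := by
  have hm : ∀ N : ℕ, MeasurableSet {x | s0 + N < |f x|} := fun N =>
    measurableSet_lt measurable_const (measurable_norm.comp hf)
  have hT := tendsto_measure_iInter_atTop (μ := μ) (s := fun N : ℕ => {x | s0 + N < |f x|})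
    (fun N => (hm N).nullMeasurableSet)
    (fun a b hab x hx => by
      simp only [mem_ofPred_eq] at hx ⊢
      have : (a:ℝ) ≤ b := by exact_mod_cast hab
      linarith) ⟨0, by simpa using h0⟩
  have he : (⋂ N : ℕ, {x | s0 + N < |f x|}) = ∅ := by
    ext x
    simp only [mem_iInter, mem_ofPred_eq, mem_empty_iff_false, iff_false, not_forall, not_lt]
    obtain ⟨N, hN⟩ := exists_nat_ge (|f x| - s0)
    exact ⟨N, by linarith⟩
  rw [he, measure_empty] at hT
  have := (hT.eventually (gt_mem_nhds (ENNReal.ofReal_pos.2 ht))).exists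
  obtain ⟨N, hN⟩ := this
  refine ⟨max 0 (s0 + N), le_max_left _ _, (measure_mono fun x hx => ?_).trans hN.le⟩
  exact lt_of_le_of_lt (le_max_right _ _) (show max 0 (s0 + (N:ℝ)) < |f x| from hx)

lemma FF_lt_top {α : Type*} [MeasurableSpace α] {μ : Measure α} {f : α → ℝ} (hf : Measurable f)
    {s0 : ℝ} (h0 : μ {x | s0 < |f x|} ≠ ∞) {t : ℝ} (ht : 0 < t) : FF μ f t < ∞ := by
  obtain ⟨s1, hs1, h1⟩ := dist_small hf h0 ht
  refine lt_of_le_of_lt (b := ENNReal.ofReal s1) (iSup₂_le fun s hs => ?_) ENNReal.ofReal_lt_top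
  by_contra hc
  push Not at hc
  have h2 : s1 < s := by
    rw [ENNReal.ofReal_lt_iff_lt_toReal hs1 (by simp)] at hc
    simpa using hc
  refine absurd hs (not_lt.2 ((measure_mono fun x hx => ?_).trans h1))
  exact h2.trans hx

lemma FF_le_rearrange {α : Type*} [MeasurableSpace α] {μ : Measure α} {f : α → ℝ}
    (hf : Measurable f) {s0 : ℝ} (h0 : μ {x | s0 < |f x|} ≠ ∞) {t : ℝ} (ht : 0 < t) :
    FF μ f t ≤ ENNReal.ofReal (rearrange μ f t) := by
  refine iSup₂_le fun s hs => ?_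
  have : (s : ℝ≥0∞) = ENNReal.ofReal (s : ℝ) := by simp
  rw [this]
  apply ENNReal.ofReal_le_ofReal
  refine le_csSup ?_ ⟨s.2, hs⟩
  refine ⟨(FF μ f t).toReal, fun r hr => ?_⟩
  rw [← ENNReal.ofReal_le_iff_le_toReal (FF_lt_top hf h0 ht).ne]
  exact le_FF hr.1 hr.2

lemma trunc_int {α : Type*} [MeasurableSpace α] {μ : Measure α} {f : α → ℝ}
    (hf : Measurable f) {s0 : ℝ} (h0 : μ {x | s0 < |f x|} ≠ ∞) {t : ℝ} (ht : 0 < t) :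
    ∫⁻ x, ENNReal.ofReal (|f x| - (FF μ f t).toReal) ∂μ ≤ ∫⁻ s in Ioo 0 t, FF μ f s := by
  set a := (FF μ f t).toReal with ha
  have hfm : Measurable fun x => |f x| := measurable_norm.comp hf
  have e1 : ∫⁻ x, ENNReal.ofReal (|f x| - a) ∂μ = ∫⁻ x, ENNReal.ofReal (max (|f x| - a) 0) ∂μ := by
    refine lintegral_congr fun x => ?_
    simp
  have hFm : Measurable (FF μ f) := (FF_antitone μ f).measurable
  have e2 : ∫⁻ s in Ioo 0 t, ENNReal.ofReal (FF μ f s).toReal ≤ ∫⁻ s in Ioo 0 t, FF μ f s :=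
    lintegral_mono fun s => ENNReal.ofReal_toReal_le
  rw [e1]
  refine le_trans ?_ e2
  rw [lintegral_eq_lintegral_meas_lt (f := fun x => max (|f x| - a) 0) μ (ae_of_all _ fun x => le_max_right _ _)
    ((hfm.sub_const a).max measurable_const).aemeasurable,
    lintegral_eq_lintegral_meas_le _ (ae_of_all _ fun x => ENNReal.toReal_nonneg)
    hFm.ennreal_toReal.aemeasurable]
  refine setLIntegral_mono' measurableSet_Ioi fun u hu => ?_
  simp only [mem_Ioi] at hu
  have hset : {x | u < max (|f x| - a) 0} = {x | u + a < |f x|} := by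
    ext x
    simp only [mem_ofPred_eq, lt_max_iff]
    constructor
    · rintro (h | h) <;> linarith
    · intro h; left; linarith
  rw [hset]
  set m := μ {x | u + a < |f x|} with hm
  have ha0 : 0 ≤ a := ENNReal.toReal_nonneg
  have hmt : m ≤ ENNReal.ofReal t := by
    by_contra hc
    push Not at hc
    have := le_FF (by linarith) hc
    rw [ENNReal.ofReal_le_iff_le_toReal (FF_lt_top hf h0 ht).ne] at this
    linarith
  have hm' : m ≠ ∞ := (hmt.trans_lt ENNReal.ofReal_lt_top).ne
  have hmr : m.toReal ≤ t := ENNReal.toReal_le_of_le_ofReal ht.le hmt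
  rw [Measure.restrict_apply (measurableSet_le measurable_const hFm.ennreal_toReal)]
  calc m = volume (Ioo 0 m.toReal) := by rw [Real.volume_Ioo, sub_zero, ENNReal.ofReal_toReal hm']
    _ ≤ _ := by
      refine measure_mono fun s hs => ⟨?_, hs.1, hs.2.trans_le hmr⟩
      have h1 : ENNReal.ofReal s < m := (ENNReal.ofReal_lt_iff_lt_toReal hs.1.le hm').2 hs.2
      have h2 := le_FF (by linarith) h1
      rw [ENNReal.ofReal_le_iff_le_toReal (FF_lt_top hf h0 hs.1).ne] at h2
      simp only [mem_ofPred_eq]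
      linarith

lemma mx_le_add {n : ℕ} {f : EuclideanSpace ℝ (Fin n) → ℝ} (a : ℝ≥0∞) (ha : a ≠ ∞)
    (x : EuclideanSpace ℝ (Fin n)) :
    mx (fun x => ENNReal.ofReal |f x|) x ≤ mx (fun x => ENNReal.ofReal (|f x| - a.toReal)) x + a := by
  refine iSup_le fun r => ?_
  have hv := (measure_closedBall_pos volume x r.2).ne'
  have hv' : volume (closedBall x (r:ℝ)) ≠ ∞ := measure_closedBall_lt_top.ne
  rw [ENNReal.div_le_iff hv hv']
  calc _ ≤ ∫⁻ y in closedBall x (r:ℝ), (ENNReal.ofReal (|f y| - a.toReal) + a) := by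
        refine lintegral_mono fun y => ?_
        simp only
        conv_rhs => rw [← ENNReal.ofReal_toReal ha, ENNReal.toReal_ofReal ENNReal.toReal_nonneg]
        refine le_trans ?_ ENNReal.ofReal_add_le
        simp
    _ = (∫⁻ y in closedBall x (r:ℝ), ENNReal.ofReal (|f y| - a.toReal)) +
          a * volume (closedBall x (r:ℝ)) := by
        rw [lintegral_add_right _ measurable_const]; simp
    _ ≤ _ := by
        rw [add_mul, mul_comm (mx _ _)]
        gcongr
        exact mx_ball _ _ r.2

lemma rearrange_bound {n : ℕ} (hn : 0 < n) {f g : EuclideanSpace ℝ (Fin n) → ℝ}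
    (hf : Measurable f) {s0 : ℝ} (h0 : volume {x | s0 < |f x|} ≠ ∞) {A : ℝ≥0∞} (hA0 : A ≠ 0)
    (hAt : A ≠ ∞) (hg : ∀ x, ENNReal.ofReal |g x| ≤ A * mx (fun x => ENNReal.ofReal |f x|) x)
    {t : ℝ} (ht : 0 < t) :
    ENNReal.ofReal (rearrange volume g t) ≤
      A * (1 + 4 ^ n) * (ENNReal.ofReal t⁻¹ * ∫⁻ s in Ioo 0 t, FF volume f s) := by
  set I := ∫⁻ s in Ioo 0 t, FF volume f s with hI
  have ht1 : ENNReal.ofReal t⁻¹ ≠ 0 := by simpa using ht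
  by_cases hIt : I = ∞
  · rw [hIt, ENNReal.mul_top ht1, ENNReal.mul_top (by positivity)]
    exact le_top
  set a := FF volume f t with ha
  have hat : a ≠ ∞ := (FF_lt_top hf h0 ht).ne
  set J := ENNReal.ofReal t⁻¹ * I with hJ
  have hJt : J ≠ ∞ := by finiteness
  have hcan : ENNReal.ofReal t⁻¹ * ENNReal.ofReal t = 1 := by
    rw [← ENNReal.ofReal_mul (inv_pos.2 ht).le, inv_mul_cancel₀ ht.ne', ENNReal.ofReal_one]
  have haJ : a ≤ J := by
    have : a * ENNReal.ofReal t ≤ I := by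
      calc a * ENNReal.ofReal t = ∫⁻ s in Ioo 0 t, a := by simp
        _ ≤ I := setLIntegral_mono' measurableSet_Ioo fun s hs => FF_antitone _ _ hs.2.le
    calc a = ENNReal.ofReal t⁻¹ * (a * ENNReal.ofReal t) := by
          rw [mul_comm a, ← mul_assoc, hcan, one_mul]
      _ ≤ J := mul_le_mul_right this _
  set f1 : EuclideanSpace ℝ (Fin n) → ℝ≥0∞ := fun x => ENNReal.ofReal (|f x| - a.toReal) with hf1
  have hf1I : ∫⁻ x, f1 x ≤ I := trunc_int hf h0 ht
  have hlev : volume {x | a + 4 ^ n * J < mx (fun x => ENNReal.ofReal |f x|) x} ≤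
      ENNReal.ofReal t := by
    have hsub : {x | a + 4 ^ n * J < mx (fun x => ENNReal.ofReal |f x|) x} ⊆
        {x | 4 ^ n * J < mx f1 x} := by
      intro x hx
      have h1 := lt_of_lt_of_le hx (mx_le_add (f := f) a hat x)
      rw [add_comm] at h1
      exact (ENNReal.add_lt_add_iff_right hat).1 h1
    refine (measure_mono hsub).trans ?_
    by_cases hI0 : I = 0
    · have : {x | 4 ^ n * J < mx f1 x} = ∅ := by
        ext x
        simp only [mem_ofPred_eq, mem_empty_iff_false, iff_false, not_lt]
        refine le_trans (iSup_le fun r => ?_) zero_le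
        have : ∫⁻ y in closedBall x (r:ℝ), f1 y = 0 :=
          le_antisymm ((setLIntegral_le_lintegral _ _).trans (hf1I.trans hI0.le)) zero_le
        rw [this]; simp
      rw [this]; simp
    · have hw := (mx_weak hn f1 (4 ^ n * J)).trans (mul_le_mul_right hf1I _)
      have h4 : (4:ℝ≥0∞) ^ n ≠ 0 := by positivity
      have h4t : (4:ℝ≥0∞) ^ n ≠ ∞ := by finiteness
      rw [mul_assoc, ENNReal.mul_le_mul_iff_right h4 h4t] at hw
      have h5 : I * (ENNReal.ofReal t⁻¹ * volume {x | 4 ^ n * J < mx f1 x}) ≤ I * 1 := by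
        rw [mul_one, ← mul_assoc, mul_comm I]; exact hw
      rw [ENNReal.mul_le_mul_iff_right hI0 hIt] at h5
      generalize volume {x | 4 ^ n * J < mx f1 x} = V at h5 ⊢
      calc V = (ENNReal.ofReal t⁻¹ * ENNReal.ofReal t) * V := by rw [hcan, one_mul]
        _ = ENNReal.ofReal t * (ENNReal.ofReal t⁻¹ * V) := by ring
        _ ≤ ENNReal.ofReal t * 1 := mul_le_mul_right h5 _
        _ = _ := mul_one _
  have hb : A * (a + 4 ^ n * J) ≤ A * (1 + 4 ^ n) * J := by
    rw [mul_assoc, add_mul, one_mul]; gcongr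
  refine le_trans ?_ hb
  have hfin : A * (a + 4 ^ n * J) ≠ ∞ := by finiteness
  rw [ENNReal.ofReal_le_iff_le_toReal hfin]
  refine Real.sSup_le (fun s hs => ?_) ENNReal.toReal_nonneg
  rw [← ENNReal.ofReal_le_iff_le_toReal hfin]
  by_contra hc
  push Not at hc
  refine absurd hs.2 (not_lt.2 ((measure_mono fun x hx => ?_).trans hlev))
  have h1 : A * (a + 4 ^ n * J) < A * mx (fun x => ENNReal.ofReal |f x|) x :=
    hc.trans_le ((ENNReal.ofReal_le_ofReal (le_of_lt hx)).trans (hg x))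
  exact (ENNReal.mul_lt_mul_iff_right hA0 hAt).1 h1

lemma classP_dev {φ : ℝ → ℝ} {φ0 φi : ℝ} (h : ClassP ∞ φ φ0 φi) :
    ∃ K : ℝ, ∀ t, 0 < t → |φ t - sw φ0 φi t| * |Real.log t| ≤ K := by
  obtain ⟨M, hM⟩ := h.bounded
  obtain ⟨C0, hC0, h0⟩ := h.decay_zero
  obtain ⟨C1, hC1, h1⟩ := h.decay_infty rfl
  have hM0 : 0 ≤ M := (abs_nonneg _).trans (hM 0 le_rfl le_top)
  have hl2 : 0 ≤ Real.log 2 := Real.log_nonneg (by norm_num)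
  refine ⟨C0 + C1 + (M + |φ0|) * Real.log 2, fun t ht => ?_⟩
  have h3 : 0 ≤ (M + |φ0|) * Real.log 2 := by positivity
  unfold sw
  split_ifs with h
  · rcases le_or_gt t (1/2) with h2 | h2
    · have hl : |Real.log t| = Real.log (1 / t) := by
        rw [abs_of_nonpos (Real.log_nonpos ht.le h.le), one_div, Real.log_inv]
      have hp : 0 < Real.log (1 / t) := Real.log_pos (by rw [lt_div_iff₀ ht]; linarith)
      have := h0 t ht h2
      rw [le_div_iff₀ hp] at this
      rw [hl]; linarith
    · have hl : |Real.log t| ≤ Real.log 2 := by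
        rw [abs_of_nonpos (Real.log_nonpos ht.le h.le), ← Real.log_inv]
        refine Real.log_le_log (inv_pos.2 ht) ?_
        rw [inv_le_comm₀ ht (by norm_num)]; linarith
      have h4 : |φ t - φ0| ≤ M + |φ0| := (abs_sub _ _).trans (by gcongr; exact hM t ht.le le_top)
      have : |φ t - φ0| * |Real.log t| ≤ (M + |φ0|) * Real.log 2 := by gcongr
      linarith
  · push Not at h
    have hl : |Real.log t| ≤ Real.log (Real.exp 1 + t) := by
      rw [abs_of_nonneg (Real.log_nonneg h)]
      exact Real.log_le_log ht (by linarith [Real.exp_pos 1])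
    have hp : 0 < Real.log (Real.exp 1 + t) := Real.log_pos (by linarith [Real.exp_pos 1])
    have := h1 t ht.le
    rw [le_div_iff₀ hp] at this
    have h5 : |φ t - φi| * |Real.log t| ≤ |φ t - φi| * Real.log (Real.exp 1 + t) := by gcongr
    linarith

lemma inv_sub_abs {x y : ℝ} (hx : 1 ≤ x) (hy : 1 ≤ y) : |1 / x - 1 / y| ≤ |x - y| := by
  have : 1 / x - 1 / y = (y - x) / (x * y) := by field_simp
  rw [this, abs_div, abs_sub_comm, abs_of_pos (a := x * y) (by positivity)]
  exact div_le_self (abs_nonneg _) (by nlinarith)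

lemma classPa_ge {p : ℝ → ℝ} {p0 pi : ℝ} (h : ClassPa 1 ∞ p p0 pi) :
    (∀ t, 0 < t → 1 ≤ p t) ∧ 1 ≤ p0 ∧ 1 ≤ pi := by
  obtain ⟨h, pm, pM, hm, hb⟩ := h
  have h1 : ∀ t, 0 < t → 1 ≤ p t := fun t ht => hm.le.trans (hb t ht.le le_top).1
  refine ⟨h1, ge_of_tendsto h.lim_zero ?_, ge_of_tendsto (h.lim_infty rfl) ?_⟩
  · filter_upwards [self_mem_nhdsWithin] with t ht using h1 t ht
  · filter_upwards [eventually_gt_atTop 0] with t ht using h1 t ht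

lemma modular_pt {t b q R : ℝ} {lam : ℝ≥0∞} (ht : 0 < t) (hq : 1 ≤ q) (hR : 0 ≤ R) :
    (ENNReal.ofReal |t ^ (b - 1 / q) * R| / lam) ^ q =
      (ENNReal.ofReal (t ^ b) * ENNReal.ofReal R / lam) ^ q * ENNReal.ofReal t⁻¹ := by
  have hq0 : 0 < q := by linarith
  have h1 : |t ^ (b - 1 / q) * R| = (t ^ b * R) * t ^ (-(1 / q)) := by
    rw [abs_of_nonneg (by positivity), sub_eq_add_neg, Real.rpow_add ht]; ring
  rw [h1, ENNReal.ofReal_mul (by positivity), ENNReal.ofReal_mul (by positivity), div_eq_mul_inv,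
    mul_right_comm, ENNReal.mul_rpow_of_nonneg _ _ hq0.le, ← div_eq_mul_inv]
  congr 1
  rw [ENNReal.ofReal_rpow_of_pos (by positivity), ← Real.rpow_mul ht.le]
  have : -(1 / q) * q = -1 := by field_simp
  rw [this, Real.rpow_neg_one]

lemma lux_bound (p q γ : ℝ → ℝ) (p0 pinf q0 qinf γ0 γinf : ℝ)
    (hp : ClassPa 1 ∞ p p0 pinf) (hq : ClassPa 1 ∞ q q0 qinf)
    (hγ : ClassP ∞ γ γ0 γinf)
    (hγ0 : γ0 < 1 - 1 / p0) (hγinf : γinf < 1 - 1 / pinf)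
    (w : ℝ → ℝ) (hw : ∀ t, w t = t ^ γ t) (A : ℝ≥0∞) (hA0 : A ≠ 0) (hAt : A ≠ ∞) :
    ∃ C : ℝ≥0∞, 0 < C ∧ C < ∞ ∧ ∀ (F : ℝ → ℝ≥0∞) (R R' : ℝ → ℝ), Antitone F →
      (∀ t, 0 ≤ R t) → (∀ t, 0 ≤ R' t) → (∀ t, 0 < t → F t ≤ ENNReal.ofReal (R t)) →
      (∀ t, 0 < t → ENNReal.ofReal (R' t) ≤ A * (ENNReal.ofReal t⁻¹ * ∫⁻ s in Ioo 0 t, F s)) →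
      luxNorm ∞ q (fun t => w t * t ^ (1 / p t - 1 / q t) * R' t) ≤
        C * luxNorm ∞ q (fun t => w t * t ^ (1 / p t - 1 / q t) * R t) := by
  obtain ⟨hp1, hp0, hpi⟩ := classPa_ge hp
  obtain ⟨hq1, hq0, hqi⟩ := classPa_ge hq
  obtain ⟨Kp, hKp⟩ := classP_dev hp.1
  obtain ⟨Kq, hKq⟩ := classP_dev hq.1
  obtain ⟨Kγ, hKγ⟩ := classP_dev hγ
  set b0 := γ0 + 1 / p0 with hb0
  set bi := γinf + 1 / pinf with hbi
  set b : ℝ → ℝ := fun t => γ t + 1 / p t with hb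
  have hdev : ∀ t, 0 < t → |b t - sw b0 bi t| * |Real.log t| ≤ Kγ + Kp := by
    intro t ht
    have h1 : b t - sw b0 bi t = (γ t - sw γ0 γinf t) + (1 / p t - 1 / sw p0 pinf t) := by
      simp only [hb, sw, hb0, hbi]; split_ifs <;> ring
    have h2 : 1 ≤ sw p0 pinf t := by unfold sw; split_ifs <;> assumption
    rw [h1]
    calc _ ≤ (|γ t - sw γ0 γinf t| + |p t - sw p0 pinf t|) * |Real.log t| := by
          gcongr
          exact (abs_add_le _ _).trans (add_le_add le_rfl (inv_sub_abs (hp1 t ht) h2))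
      _ ≤ _ := by rw [add_mul]; exact add_le_add (hKγ t ht) (hKp t ht)
  set β := max (max b0 bi) 0 with hβ
  obtain ⟨Ch, hCh1, hCht, hH⟩ := hardy hq.1.measurable hq1 hq0 hqi hKq (b0 := b0) (bi := bi) (β := β)
    ((le_max_left _ _).trans (le_max_left _ _)) ((le_max_right _ _).trans (le_max_left _ _))
    (le_max_right _ _) (max_lt (max_lt (by linarith) (by linarith)) one_pos)
  set E := ENNReal.ofReal (Real.exp (Kγ + Kp)) with hE
  have hE0 : E ≠ 0 := by simp [hE, Real.exp_pos]
  have hEt : E ≠ ∞ := ENNReal.ofReal_ne_top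
  have hCh0 : Ch ≠ 0 := (one_pos.trans_le hCh1).ne'
  have hcmp1 : ∀ t, 0 < t → ENNReal.ofReal (t ^ b t) ≤ E * ENNReal.ofReal (t ^ sw b0 bi t) := by
    intro t ht
    rw [← ENNReal.ofReal_mul (Real.exp_pos _).le]
    apply ENNReal.ofReal_le_ofReal
    calc t ^ b t = t ^ (b t - sw b0 bi t) * t ^ sw b0 bi t := by rw [← Real.rpow_add ht]; ring_nf
      _ ≤ _ := by gcongr; exact rpow_le_exp ht (hdev t ht)
  have hcmp2 : ∀ t, 0 < t → ENNReal.ofReal (t ^ sw b0 bi t) ≤ E * ENNReal.ofReal (t ^ b t) := by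
    intro t ht
    rw [← ENNReal.ofReal_mul (Real.exp_pos _).le]
    apply ENNReal.ofReal_le_ofReal
    calc t ^ sw b0 bi t = t ^ (sw b0 bi t - b t) * t ^ b t := by rw [← Real.rpow_add ht]; ring_nf
      _ ≤ _ := by gcongr; exact rpow_le_exp ht (by rw [abs_sub_comm]; exact hdev t ht)
  set C := A * E * E * Ch with hC
  have hC0 : C ≠ 0 := by positivity
  have hCt : C ≠ ∞ := by finiteness
  refine ⟨C, hC0.bot_lt, hCt.lt_top, fun F R R' hF hR hR' hFR hR'F => ?_⟩
  have hdom : {t : ℝ | 0 < t ∧ ENNReal.ofReal t < ∞} = Ioi 0 := by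
    ext t; simp
  have hmod : ∀ (S : ℝ → ℝ) (hS : ∀ t, 0 ≤ S t) (lam : ℝ≥0∞),
      ∫⁻ t in Ioi (0:ℝ), (ENNReal.ofReal |w t * t ^ (1 / p t - 1 / q t) * S t| / lam) ^ q t =
      ∫⁻ t in Ioi (0:ℝ), (ENNReal.ofReal (t ^ b t) * ENNReal.ofReal (S t) / lam) ^ q t *
        ENNReal.ofReal t⁻¹ := by
    intro S hS lam
    refine setLIntegral_congr_fun measurableSet_Ioi fun t ht => ?_
    have ht' : (0:ℝ) < t := ht
    rw [← modular_pt ht' (hq1 t ht') (hS t), hw, ← Real.rpow_add ht']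
    simp only [hb]
    ring_nf
  unfold luxNorm
  rw [hdom]
  refine (ENNReal.div_le_iff' hC0 hCt).1 (le_sInf fun lam hlam => ?_)
  obtain ⟨hl0, hl⟩ := hlam
  rw [ENNReal.div_le_iff' hC0 hCt]
  by_cases hlt : lam = ∞
  · rw [hlt, ENNReal.mul_top hC0]; exact le_top
  refine sInf_le ⟨?_, ?_⟩
  · exact (ENNReal.mul_pos hC0 hl0.ne')
  rw [hmod R' hR']
  rw [hmod R hR] at hl
  have hk0 : lam * E ≠ 0 := mul_ne_zero hl0.ne' hE0
  have hkt : lam * E ≠ ∞ := ENNReal.mul_ne_top hlt hEt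
  have hEE : E * E⁻¹ = 1 := ENNReal.mul_inv_cancel hE0 hEt
  have hAA : A * A⁻¹ = 1 := ENNReal.mul_inv_cancel hA0 hAt
  have hinv : (lam * E)⁻¹ = lam⁻¹ * E⁻¹ := ENNReal.mul_inv (Or.inl hl0.ne') (Or.inl hlt)
  have hinvC : (C * lam)⁻¹ = A⁻¹ * E⁻¹ * E⁻¹ * Ch⁻¹ * lam⁻¹ := by
    rw [ENNReal.mul_inv (Or.inl hC0) (Or.inl hCt), hC,
      ENNReal.mul_inv (Or.inr hCht.ne) (Or.inr hCh0),
      ENNReal.mul_inv (Or.inr hEt) (Or.inr hE0), ENNReal.mul_inv (Or.inr hEt) (Or.inr hE0)]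
  have hG := hH (fun t => F t * (lam * E)⁻¹) (fun x y hxy => mul_le_mul_left (hF hxy) _) ?_
  · refine le_trans (setLIntegral_mono' measurableSet_Ioi fun t ht => ?_) hG
    have ht' : (0:ℝ) < t := ht
    refine mul_le_mul_left (ENNReal.rpow_le_rpow ?_ (by linarith [hq1 t ht'])) _
    rw [lintegral_mul_const' _ _ (ENNReal.inv_ne_top.2 hk0), div_eq_mul_inv, div_eq_mul_inv, hinvC,
      hinv]
    calc _ ≤ (E * ENNReal.ofReal (t ^ sw b0 bi t)) *
          (A * (ENNReal.ofReal t⁻¹ * ∫⁻ s in Ioo 0 t, F s)) *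
          (A⁻¹ * E⁻¹ * E⁻¹ * Ch⁻¹ * lam⁻¹) := by
          gcongr
          · exact hcmp1 t ht'
          · exact hR'F t ht'
      _ = (E * E⁻¹) * (A * A⁻¹) * (ENNReal.ofReal (t ^ sw b0 bi t) * (ENNReal.ofReal t⁻¹ *
            ((∫⁻ s in Ioo 0 t, F s) * (lam⁻¹ * E⁻¹))) * Ch⁻¹) := by ring
      _ = _ := by rw [hEE, hAA, one_mul, one_mul]
  · refine le_trans (setLIntegral_mono' measurableSet_Ioi fun t ht => ?_) hl
    have ht' : (0:ℝ) < t := ht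
    refine mul_le_mul_left (ENNReal.rpow_le_rpow ?_ (by linarith [hq1 t ht'])) _
    rw [hinv, div_eq_mul_inv]
    calc _ ≤ (E * ENNReal.ofReal (t ^ b t)) * (ENNReal.ofReal (R t) * (lam⁻¹ * E⁻¹)) := by
          gcongr
          · exact hcmp2 t ht'
          · exact hFR t ht'
      _ = (E * E⁻¹) * (ENNReal.ofReal (t ^ b t) * ENNReal.ofReal (R t) * lam⁻¹) := by ring
      _ = _ := by rw [hEE, one_mul]

lemma pk_cmp {n : ℕ} {y y' κ : ℝ} {v v' : EuclideanSpace ℝ (Fin n)} (hy : 0 < y) (hy' : 0 < y')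
    (hκ : 0 < κ) (h : ‖v'‖ ^ 2 + y' ^ 2 ≤ κ * (‖v‖ ^ 2 + y ^ 2)) :
    pk n y v ≤ y / y' * κ ^ (((n : ℝ) + 1) / 2) * pk n y' v' := by
  unfold pk
  set m := ((n : ℝ) + 1) / 2 with hm
  have hm0 : 0 < m := by positivity
  set a := ‖v‖ ^ 2 + y ^ 2 with ha
  set b := ‖v'‖ ^ 2 + y' ^ 2 with hb
  have ha0 : 0 < a := by positivity
  have hb0 : 0 < b := by positivity
  have h1 : (κ * a) ^ (-m) ≤ b ^ (-m) := Real.rpow_le_rpow_of_nonpos hb0 h (by linarith)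
  rw [Real.mul_rpow hκ.le ha0.le] at h1
  have h2 : κ ^ m * κ ^ (-m) = 1 := by rw [← Real.rpow_add hκ]; simp
  have h3 : a ^ (-m) ≤ κ ^ m * b ^ (-m) := by
    calc a ^ (-m) = κ ^ m * (κ ^ (-m) * a ^ (-m)) := by rw [← mul_assoc, h2, one_mul]
      _ ≤ _ := by gcongr
  calc y * a ^ (-m) ≤ y * (κ ^ m * b ^ (-m)) := by gcongr
    _ = _ := by field_simp

lemma norm_sq_shift {n : ℕ} (x x' ξ : EuclideanSpace ℝ (Fin n)) :
    ‖x' - ξ‖ ^ 2 ≤ 2 * ‖x - ξ‖ ^ 2 + 2 * ‖x' - x‖ ^ 2 := by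
  have h : ‖x' - ξ‖ ≤ ‖x - ξ‖ + ‖x' - x‖ := by
    calc ‖x' - ξ‖ = ‖(x - ξ) + (x' - x)‖ := by congr 1; abel
      _ ≤ _ := norm_add_le _ _
  nlinarith [norm_nonneg (x' - ξ), sq_nonneg (‖x - ξ‖ - ‖x' - x‖)]

lemma pk_measurable (n : ℕ) (y : ℝ) : Measurable (pk n y) := by
  unfold pk; fun_prop

lemma pk_shift {n : ℕ} {y y' : ℝ} (hy : 0 < y) (hy' : 0 < y') (x x' : EuclideanSpace ℝ (Fin n)) :
    ∃ C : ℝ, 0 ≤ C ∧ ∀ ξ, pk n y (x - ξ) ≤ C * pk n y' (x' - ξ) := by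
  set κ := 2 + (2 * ‖x' - x‖ ^ 2 + y' ^ 2) / y ^ 2 with hκ
  have hκ0 : 0 < κ := by positivity
  refine ⟨y / y' * κ ^ (((n : ℝ) + 1) / 2), by positivity, fun ξ => pk_cmp hy hy' hκ0 ?_⟩
  have h1 := norm_sq_shift x x' ξ
  have h2 : (2 * ‖x' - x‖ ^ 2 + y' ^ 2) / y ^ 2 * y ^ 2 = 2 * ‖x' - x‖ ^ 2 + y' ^ 2 := by
    field_simp
  have h3 : 0 ≤ (2 * ‖x' - x‖ ^ 2 + y' ^ 2) / y ^ 2 * ‖x - ξ‖ ^ 2 := by positivity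
  rw [hκ, add_mul, mul_add ((2 * ‖x' - x‖ ^ 2 + y' ^ 2) / y ^ 2), h2]
  nlinarith [sq_nonneg y]

lemma pk_integrable_shift {n : ℕ} {f : EuclideanSpace ℝ (Fin n) → ℝ} (hf : Measurable f)
    {y y' : ℝ} (hy : 0 < y) (hy' : 0 < y') {x x' : EuclideanSpace ℝ (Fin n)}
    (h : Integrable fun ξ => pk n y' (x' - ξ) * f ξ) : Integrable fun ξ => pk n y (x - ξ) * f ξ := by
  obtain ⟨C, hC0, hC⟩ := pk_shift (n := n) hy hy' x x'
  refine (h.norm.const_mul C).mono' ?_ (ae_of_all _ fun ξ => ?_)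
  · exact (((pk_measurable n y).comp (measurable_const.sub measurable_id)).mul hf).aestronglyMeasurable
  · rw [norm_mul, norm_mul, Real.norm_of_nonneg (pk_nonneg hy _), Real.norm_of_nonneg (pk_nonneg hy' _),
      ← mul_assoc]
    gcongr
    exact hC ξ

lemma rpow_neg_ge {x m : ℝ} (hx : 0 < x) (hm : 0 ≤ m) : 1 - m * (x - 1) ≤ x ^ (-m) := by
  rw [Real.rpow_def_of_pos hx]
  have h1 := Real.add_one_le_exp (Real.log x * -m)
  have h2 := Real.log_le_sub_one_of_pos hx
  nlinarith

lemma rpow_neg_lip {r m κ : ℝ} (hr : 0 < r) (hm : 0 < m) (hκ : 1 ≤ κ) (h1 : 1 ≤ κ * r) :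
    |r ^ (-m) - 1| ≤ m * κ ^ (m + 1) * |r - 1| := by
  have hκ0 : 0 < κ := by linarith
  have hk1 : 1 ≤ κ ^ (m + 1) := Real.one_le_rpow hκ (by linarith)
  have ha : 0 ≤ |r - 1| := abs_nonneg _
  rw [abs_le]
  constructor
  · have h2 := rpow_neg_ge hr hm.le
    have h3 : m * (r - 1) ≤ m * |r - 1| := by gcongr; exact le_abs_self _
    have h4 : m * |r - 1| ≤ m * κ ^ (m + 1) * |r - 1| := by
      gcongr; exact le_mul_of_one_le_right hm.le hk1
    linarith
  · have h2 := rpow_neg_ge (inv_pos.2 hr) hm.le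
    rw [Real.inv_rpow hr.le, Real.rpow_neg hr.le, inv_inv] at h2
    have h3 : r ^ (-m) * r ^ m = 1 := by rw [← Real.rpow_add hr]; simp
    have h5 : r⁻¹ ≤ κ := by rw [inv_le_iff_one_le_mul₀ hr]; exact h1
    have h6 : r ^ (-m) ≤ κ ^ m := by
      rw [Real.rpow_neg hr.le, ← Real.inv_rpow hr.le]
      exact Real.rpow_le_rpow (inv_pos.2 hr).le h5 hm.le
    have h7 : r⁻¹ - 1 ≤ κ * |r - 1| := by
      calc r⁻¹ - 1 = r⁻¹ * (1 - r) := by field_simp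
        _ ≤ r⁻¹ * |r - 1| := by
            have := inv_pos.2 hr
            gcongr; rw [abs_sub_comm]; exact le_abs_self _
        _ ≤ _ := by gcongr
    calc r ^ (-m) - 1 = r ^ (-m) * (1 - r ^ m) := by rw [mul_sub, h3, mul_one]
      _ ≤ r ^ (-m) * (m * (κ * |r - 1|)) := by
          have : 1 - r ^ m ≤ m * (κ * |r - 1|) := by nlinarith
          gcongr
      _ ≤ κ ^ m * (m * (κ * |r - 1|)) := by gcongr
      _ = _ := by rw [Real.rpow_add hκ0, Real.rpow_one]; ring

lemma pk_diff {n : ℕ} (x x' : EuclideanSpace ℝ (Fin n)) :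
    ∃ C : ℝ, 0 ≤ C ∧ ∀ y : ℝ, 1 ≤ y → ∀ ξ,
      |pk n y (x - ξ) - pk n y (x' - ξ)| ≤ C * pk n 1 (x' - ξ) := by
  set d := ‖x' - x‖ with hd
  have hd0 : 0 ≤ d := norm_nonneg _
  set κ := 2 + 2 * d ^ 2 with hκ
  have hκ1 : 1 ≤ κ := by nlinarith [sq_nonneg d]
  set m := ((n : ℝ) + 1) / 2 with hm
  have hm0 : 0 < m := by positivity
  refine ⟨m * κ ^ (m + 1) * (d * (2 + d)), by positivity, fun y hy ξ => ?_⟩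
  have hs := norm_sq_shift x x' ξ
  have hy0 : 0 < y := by linarith
  unfold pk
  rw [← hm]
  set V := ‖x - ξ‖ with hV
  set V' := ‖x' - ξ‖ with hV'
  have hV0 : 0 ≤ V := norm_nonneg _
  have hV0' : 0 ≤ V' := norm_nonneg _
  have hVV : |V - V'| ≤ d := by
    refine (abs_norm_sub_norm_le _ _).trans ?_
    rw [hd, norm_sub_rev x']; simp
  set a := V ^ 2 + y ^ 2 with ha
  set b := V' ^ 2 + y ^ 2 with hb
  have ha0 : 0 < a := by positivity
  have hb0 : 0 < b := by positivity
  have hba : b ≤ κ * a := by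
    rw [hκ, ha, hb]
    nlinarith [mul_nonneg (sq_nonneg d) (sq_nonneg V), mul_nonneg (sq_nonneg d) (by nlinarith : 0 ≤ y ^ 2 - 1)]
  have hL := rpow_neg_lip (r := a / b) (m := m) (κ := κ) (by positivity) hm0 hκ1
    (by rw [← mul_div_assoc, le_div_iff₀ hb0]; linarith)
  have hab : a ^ (-m) = b ^ (-m) * (a / b) ^ (-m) := by
    rw [← Real.mul_rpow hb0.le (by positivity)]; congr 1; field_simp
  have hyr : y * |a / b - 1| ≤ d * (2 + d) := by
    have e1 : a / b - 1 = (V - V') * (V + V') / b := by rw [ha, hb]; field_simp; ring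
    rw [e1, abs_div, abs_mul, abs_of_pos hb0, abs_of_nonneg (by positivity : 0 ≤ V + V'),
      ← mul_div_assoc, div_le_iff₀ hb0]
    have h1 : V + V' ≤ 2 * V' + d := by linarith [(abs_le.1 hVV).2]
    have h2 : y * (2 * V' + d) ≤ (2 + d) * b := by
      rw [hb]
      nlinarith [sq_nonneg (V' - y), sq_nonneg V', mul_nonneg hd0 (sq_nonneg V'),
        mul_nonneg hd0 (by nlinarith : 0 ≤ y ^ 2 - y)]
    calc y * (|V - V'| * (V + V')) ≤ y * (d * (2 * V' + d)) := by gcongr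
      _ = d * (y * (2 * V' + d)) := by ring
      _ ≤ d * ((2 + d) * b) := by gcongr
      _ = _ := by ring
  have hb1 : b ^ (-m) ≤ (V' ^ 2 + 1 ^ 2) ^ (-m) :=
    Real.rpow_le_rpow_of_nonpos (by positivity) (by rw [hb]; nlinarith) (by linarith)
  calc |y * a ^ (-m) - y * b ^ (-m)| = b ^ (-m) * (y * |(a / b) ^ (-m) - 1|) := by
        rw [hab]
        have : y * (b ^ (-m) * (a / b) ^ (-m)) - y * b ^ (-m) =
          b ^ (-m) * (y * ((a / b) ^ (-m) - 1)) := by ring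
        rw [this, abs_mul, abs_mul, abs_of_pos hy0, abs_of_pos (Real.rpow_pos_of_pos hb0 _)]
    _ ≤ b ^ (-m) * (y * (m * κ ^ (m + 1) * |a / b - 1|)) := by gcongr
    _ = b ^ (-m) * (m * κ ^ (m + 1) * (y * |a / b - 1|)) := by ring
    _ ≤ (V' ^ 2 + 1 ^ 2) ^ (-m) * (m * κ ^ (m + 1) * (d * (2 + d))) := by gcongr
    _ = _ := by ring

/-- unnormalized Poisson integral -/
def UU (n : ℕ) (f : EuclideanSpace ℝ (Fin n) → ℝ) (x : EuclideanSpace ℝ (Fin n)) (y : ℝ) : ℝ :=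
  ∫ ξ, pk n y (x - ξ) * f ξ

lemma UU_diff {n : ℕ} {f : EuclideanSpace ℝ (Fin n) → ℝ} (hf : Measurable f)
    (h : Integrable fun ξ => pk n 1 (0 - ξ) * f ξ) (x x' : EuclideanSpace ℝ (Fin n)) :
    ∃ C : ℝ, ∀ y : ℝ, 1 ≤ y → |UU n f x y - UU n f x' y| ≤ C := by
  obtain ⟨C, hC0, hC⟩ := pk_diff x x'
  refine ⟨∫ ξ, C * ‖pk n 1 (x' - ξ) * f ξ‖, fun y hy => ?_⟩
  have hy0 : 0 < y := by linarith
  unfold UU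
  rw [← integral_sub (pk_integrable_shift hf hy0 one_pos h) (pk_integrable_shift hf hy0 one_pos h),
    ← Real.norm_eq_abs]
  refine norm_integral_le_of_norm_le ((pk_integrable_shift hf one_pos one_pos h).norm.const_mul C)
    (ae_of_all _ fun ξ => ?_)
  rw [← sub_mul, norm_mul, norm_mul, Real.norm_of_nonneg (pk_nonneg one_pos _), ← mul_assoc,
    Real.norm_eq_abs]
  gcongr
  exact hC y hy ξ

lemma loc_int {n : ℕ} {f : EuclideanSpace ℝ (Fin n) → ℝ}
    (h : Integrable fun ξ => pk n 1 (0 - ξ) * f ξ) : LocallyIntegrable f := by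
  have hc : Continuous fun ξ : EuclideanSpace ℝ (Fin n) => (pk n 1 (0 - ξ))⁻¹ := by
    refine Continuous.inv₀ ?_ fun ξ => (pk_pos one_pos _).ne'
    unfold pk
    refine continuous_const.mul (Continuous.rpow_const (by fun_prop) fun ξ => Or.inl ?_)
    positivity
  have := h.locallyIntegrable.continuous_mul hc
  refine this.congr (ae_of_all _ fun ξ => ?_)
  have := (pk_pos (n := n) one_pos (0 - ξ)).ne'
  field_simp

lemma near_zero {n : ℕ} {f : EuclideanSpace ℝ (Fin n) → ℝ} (hf : Measurable f)
    (h : Integrable fun ξ => pk n 1 (0 - ξ) * f ξ)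
    (h1 : Integrable fun ξ : EuclideanSpace ℝ (Fin n) => pk n 1 (0 - ξ) * (1:ℝ)) :
    ∀ᵐ x, Tendsto (fun y => ∫⁻ ξ, ENNReal.ofReal (pk n y (x - ξ)) * ‖f ξ - f x‖ₑ) (𝓝[>] 0) (𝓝 0) := by
  have hL := VitaliFamily.ae_tendsto_lintegral_enorm_sub_div
    (Besicovitch.vitaliFamily (volume : Measure (EuclideanSpace ℝ (Fin n)))) (loc_int h)
  filter_upwards [hL] with x hx
  have hx := hx.comp (Besicovitch.tendsto_filterAt volume x)
  rw [ENNReal.tendsto_nhds_zero] at hx ⊢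
  intro ε hε
  set B := 2 ^ (n + 2) * volume (ball (0 : EuclideanSpace ℝ (Fin n)) 1) with hB
  have hB0 : B ≠ 0 := mul_ne_zero (by positivity) om_ne_zero
  have hBt : B ≠ ∞ := ENNReal.mul_ne_top (by finiteness) om_ne_top
  have hε1 : 0 < ε / 2 / B := ENNReal.div_pos (ENNReal.div_pos hε.ne' (by simp)).ne' hBt
  obtain ⟨δ, hδ, hδs⟩ := mem_nhdsGT_iff_exists_Ioc_subset.1 (hx _ hε1)
  have hδ : 0 < δ := hδ
  have hball : ∀ r : ℝ, 0 < r → r ≤ δ → ∫⁻ y in closedBall x r, ‖f y - f x‖ₑ ≤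
      ε / 2 / B * volume (closedBall x r) := by
    intro r hr hrd
    have := hδs (show r ∈ Ioc 0 δ from ⟨hr, hrd⟩)
    rw [← ENNReal.div_le_iff (measure_closedBall_pos _ _ hr).ne' measure_closedBall_lt_top.ne]
    exact this
  have hem : Measurable fun ξ => ‖f ξ - f x‖ₑ := (hf.sub_const _).enorm
  set g : EuclideanSpace ℝ (Fin n) → ℝ≥0∞ := (closedBall x δ).indicator fun ξ => ‖f ξ - f x‖ₑ with hg
  have hgm : Measurable g := hem.indicator measurableSet_closedBall
  have hmx : mx g x ≤ ε / 2 / B := by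
    refine iSup_le fun r => ?_
    rw [ENNReal.div_le_iff (measure_closedBall_pos _ _ r.2).ne' measure_closedBall_lt_top.ne]
    rcases le_total (r:ℝ) δ with h2 | h2
    · refine le_trans (lintegral_mono fun y => ?_) (hball r r.2 h2)
      exact indicator_le_self _ _ _
    · calc ∫⁻ y in closedBall x (r:ℝ), g y ≤ ∫⁻ y, g y := setLIntegral_le_lintegral _ _
        _ = ∫⁻ y in closedBall x δ, ‖f y - f x‖ₑ := lintegral_indicator measurableSet_closedBall _
        _ ≤ _ := hball δ hδ le_rfl
        _ ≤ _ := mul_le_mul_right (measure_mono (closedBall_subset_closedBall h2)) _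
  have hi : Integrable fun ξ => pk n 1 (x - ξ) * (f ξ - f x) := by
    have e1 := pk_integrable_shift hf one_pos one_pos h (x := x)
    have e2 := (pk_integrable_shift measurable_const one_pos one_pos h1 (x := x)).mul_const (f x)
    refine (e1.sub e2).congr (ae_of_all _ fun ξ => ?_)
    simp only [Pi.sub_apply]; ring
  set T := ∫⁻ ξ, ‖pk n 1 (x - ξ) * (f ξ - f x)‖ₑ with hT
  have hTt : T ≠ ∞ := hi.2.ne
  set κ := 1 + 1 / δ ^ 2 with hκ
  have hκ0 : 0 < κ := by positivity
  set D := κ ^ (((n : ℝ) + 1) / 2) with hD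
  have hD0 : 0 ≤ D := by positivity
  have hpt : ∀ y : ℝ, 0 < y → ∫⁻ ξ, ENNReal.ofReal (pk n y (x - ξ)) * ‖f ξ - f x‖ₑ ≤
      ε / 2 + ENNReal.ofReal (y * D) * T := by
    intro y hy
    have hb : ∀ ξ, ENNReal.ofReal (pk n y (x - ξ)) * ‖f ξ - f x‖ₑ ≤
        ENNReal.ofReal (pk n y (x - ξ)) * g ξ +
          ENNReal.ofReal (y * D) * ‖pk n 1 (x - ξ) * (f ξ - f x)‖ₑ := by
      intro ξ
      by_cases hξ : ξ ∈ closedBall x δ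
      · rw [hg, indicator_of_mem hξ]; exact le_self_add
      · refine le_trans ?_ le_add_self
        rw [enorm_mul, Real.enorm_of_nonneg (pk_nonneg one_pos _), ← mul_assoc,
          ← ENNReal.ofReal_mul (by positivity)]
        gcongr
        have := pk_cmp (n := n) (y' := 1) (v := x - ξ) (v' := x - ξ) hy one_pos hκ0 ?_
        · simpa using this
        · rw [mem_closedBall, dist_comm, dist_eq_norm] at hξ
          push Not at hξ
          have h4 : δ ^ 2 ≤ ‖x - ξ‖ ^ 2 := by gcongr
          have h5 : 1 ≤ 1 / δ ^ 2 * ‖x - ξ‖ ^ 2 := by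
            rw [one_div, ← div_eq_inv_mul, le_div_iff₀ (by positivity)]; linarith
          have h6 : 0 ≤ 1 / δ ^ 2 * y ^ 2 := by positivity
          rw [hκ]
          nlinarith [sq_nonneg y]
    calc _ ≤ _ := lintegral_mono hb
      _ = (∫⁻ ξ, ENNReal.ofReal (pk n y (x - ξ)) * g ξ) + ENNReal.ofReal (y * D) * T := by
          rw [lintegral_add_left, lintegral_const_mul' _ _ ENNReal.ofReal_ne_top]
          exact (((pk_measurable n y).comp (measurable_const.sub measurable_id)).ennreal_ofReal).mul hgm
      _ ≤ _ := by
          refine add_le_add ((poisson_le_mx hy hgm x).trans ?_) le_rfl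
          refine (mul_le_mul_right hmx _).trans ?_
          rw [← hB]; exact ENNReal.mul_div_le
  have hlim : Tendsto (fun y : ℝ => ENNReal.ofReal (y * D) * T) (𝓝[>] 0) (𝓝 0) := by
    have e : Tendsto (fun y : ℝ => ENNReal.ofReal (y * D)) (𝓝[>] 0) (𝓝 0) := by
      have : Continuous fun y : ℝ => ENNReal.ofReal (y * D) :=
        ENNReal.continuous_ofReal.comp (continuous_id.mul continuous_const)
      have := (this.tendsto 0).mono_left (nhdsWithin_le_nhds (s := Ioi 0))
      simpa using this
    have := ENNReal.Tendsto.mul_const e (Or.inr hTt)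
    simpa using this
  have hev := (ENNReal.tendsto_nhds_zero.1 hlim) (ε / 2) (ENNReal.div_pos hε.ne' (by simp))
  filter_upwards [hev, self_mem_nhdsWithin] with y hy1 hy2
  refine (hpt y hy2).trans ((add_le_add le_rfl hy1).trans ?_)
  rw [ENNReal.add_halves]

lemma UU_tendsto {n : ℕ} {f : EuclideanSpace ℝ (Fin n) → ℝ} (hf : Measurable f)
    (h : Integrable fun ξ => pk n 1 (0 - ξ) * f ξ) {c : ℝ}
    (hc : ∀ y : ℝ, 0 < y → ∫ x : EuclideanSpace ℝ (Fin n), c * pk n y x = 1) :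
    ∀ᵐ x, Tendsto (fun y => c * UU n f x y) (𝓝[>] 0) (𝓝 (f x)) := by
  have hc0 : c ≠ 0 := by
    rintro rfl
    have := hc 1 one_pos
    simp at this
  have hc' : ∀ y : ℝ, 0 < y → ∀ x, c * ∫ ξ : EuclideanSpace ℝ (Fin n), pk n y (x - ξ) = 1 := by
    intro y hy x
    rw [← hc y hy, integral_const_mul, integral_sub_left_eq_self (fun ξ => pk n y ξ)]
  have h1 : ∀ y : ℝ, 0 < y → ∀ x, Integrable fun ξ : EuclideanSpace ℝ (Fin n) => pk n y (x - ξ) := by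
    intro y hy x
    by_contra hni
    have := hc' y hy x
    rw [integral_undef hni] at this
    simp at this
  filter_upwards [near_zero hf h (by simpa using h1 1 one_pos 0)] with x hx
  rw [tendsto_iff_edist_tendsto_0]
  have hx2 : Tendsto (fun y => ‖c‖ₑ * ∫⁻ ξ, ENNReal.ofReal (pk n y (x - ξ)) * ‖f ξ - f x‖ₑ)
      (𝓝[>] 0) (𝓝 0) := by
    have := ENNReal.Tendsto.const_mul (a := ‖c‖ₑ) hx (Or.inr enorm_ne_top)
    simpa using this
  refine tendsto_of_tendsto_of_tendsto_of_le_of_le' tendsto_const_nhds hx2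
    (Eventually.of_forall fun _ => zero_le) ?_
  filter_upwards [self_mem_nhdsWithin] with y hy
  have hy : 0 < y := hy
  have e1 : c * UU n f x y - f x = c * ∫ ξ, pk n y (x - ξ) * (f ξ - f x) := by
    have : ∫ ξ, pk n y (x - ξ) * (f ξ - f x) =
        (∫ ξ, pk n y (x - ξ) * f ξ) - (∫ ξ, pk n y (x - ξ)) * f x := by
      rw [← integral_mul_const, ← integral_sub (pk_integrable_shift hf hy one_pos h)
        ((h1 y hy x).mul_const _)]
      congr 1; ext ξ; ring
    rw [this, mul_sub, ← mul_assoc c, hc' y hy x, one_mul]; rfl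
  rw [edist_eq_enorm_sub, e1, enorm_mul]
  refine mul_le_mul_right ((enorm_integral_le_lintegral_enorm _).trans (lintegral_mono fun ξ => ?_)) _
  simp only
  rw [enorm_mul, Real.enorm_of_nonneg (pk_nonneg hy _)]

lemma UU_bdd {n : ℕ} {f : EuclideanSpace ℝ (Fin n) → ℝ} (hf : Measurable f)
    (h : Integrable fun ξ => pk n 1 (0 - ξ) * f ξ) {c : ℝ} {x : EuclideanSpace ℝ (Fin n)}
    (hx : Tendsto (fun y => c * UU n f x y) (𝓝[>] 0) (𝓝 (f x))) {M : ℝ}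
    (hM : ∀ y, 1 ≤ y → |c * UU n f x y| ≤ M) :
    BddAbove (range fun y : {y : ℝ // 0 < y} => |c * UU n f x y|) := by
  have hev : ∀ᶠ y in 𝓝[>] (0:ℝ), |c * UU n f x y| ≤ |f x| + 1 :=
    (hx.abs.eventually (gt_mem_nhds (lt_add_one _))).mono fun _ h => le_of_lt h
  obtain ⟨η, hη, hηs⟩ := mem_nhdsGT_iff_exists_Ioc_subset.1 hev
  have hη : 0 < η := hη
  set κ := 1 + 1 / η ^ 2 with hκ
  have hκ0 : 0 < κ := by positivity
  set D := κ ^ (((n : ℝ) + 1) / 2) with hD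
  have hD0 : 0 ≤ D := by positivity
  set T := ∫ ξ, D * ‖pk n 1 (x - ξ) * f ξ‖ with hT
  have hT0 : 0 ≤ T := integral_nonneg fun ξ => by positivity
  have hM0 : 0 ≤ M := (abs_nonneg _).trans (hM 1 le_rfl)
  refine ⟨M + (|f x| + 1) + |c| * T, ?_⟩
  rintro _ ⟨⟨y, hy⟩, rfl⟩
  simp only
  have hfx := abs_nonneg (f x)
  have hcT : 0 ≤ |c| * T := by positivity
  rcases le_total 1 y with h1 | h1
  · linarith [hM y h1]
  rcases le_total y η with h2 | h2
  · have : |c * UU n f x y| ≤ |f x| + 1 := hηs (show y ∈ Ioc 0 η from ⟨hy, h2⟩)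
    linarith
  have : |c * UU n f x y| ≤ |c| * T := by
    rw [abs_mul]
    gcongr
    rw [← Real.norm_eq_abs]
    refine norm_integral_le_of_norm_le ((pk_integrable_shift hf one_pos one_pos h).norm.const_mul D)
      (ae_of_all _ fun ξ => ?_)
    rw [norm_mul, norm_mul, Real.norm_of_nonneg (pk_nonneg one_pos _),
      Real.norm_of_nonneg (pk_nonneg hy _), ← mul_assoc]
    gcongr
    have h3 := pk_cmp (n := n) (y' := 1) (v := x - ξ) (v' := x - ξ) hy one_pos hκ0 ?_
    · refine h3.trans ?_
      have := pk_nonneg (n := n) one_pos (x - ξ)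
      gcongr
      rw [div_one]
      exact mul_le_of_le_one_left hD0 h1
    · have h4 : η ^ 2 ≤ y ^ 2 := by gcongr
      have h5 : 1 ≤ 1 / η ^ 2 * y ^ 2 := by
        rw [one_div, ← div_eq_inv_mul, le_div_iff₀ (by positivity)]; linarith
      have h6 : 0 ≤ 1 / η ^ 2 * ‖x - ξ‖ ^ 2 := by positivity
      rw [hκ]
      nlinarith [sq_nonneg y]
  linarith

lemma junk_case {n : ℕ} {f : EuclideanSpace ℝ (Fin n) → ℝ} (hf : Measurable f) {c : ℝ}
    (hc : ∀ y : ℝ, 0 < y → ∫ x : EuclideanSpace ℝ (Fin n), c * pk n y x = 1)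
    (hinf : ∀ s : ℝ, volume {x | s < |f x|} = ∞) (t : ℝ) :
    rearrange volume (fun x => ⨆ y : {y : ℝ // 0 < y}, |c * UU n f x y|) t = 0 := by
  have hc0 : c ≠ 0 := by
    rintro rfl
    have := hc 1 one_pos
    simp at this
  have hzero : ∀ g : EuclideanSpace ℝ (Fin n) → ℝ, (∀ x, g x = 0) → rearrange volume g t = 0 := by
    intro g hg
    unfold rearrange
    have : {s : ℝ | 0 ≤ s ∧ ENNReal.ofReal t < volume {x | s < |g x|}} = ∅ := by
      ext s
      simp only [mem_ofPred_eq, mem_empty_iff_false, iff_false, not_and]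
      intro hs
      have : {x | s < |g x|} = ∅ := by
        ext x; simp [hg x, hs]
      rw [this]; simp
    rw [this, Real.sSup_empty]
  by_cases h : Integrable fun ξ => pk n 1 (0 - ξ) * f ξ
  swap
  · refine hzero _ fun x => ?_
    have : ∀ y : {y : ℝ // 0 < y}, |c * UU n f x y| = 0 := by
      intro y
      unfold UU
      rw [integral_undef fun hi => h (pk_integrable_shift hf one_pos y.2 hi)]; simp
    simp [this]
  by_cases hM : ∃ M : ℝ, ∀ y, 1 ≤ y → |c * UU n f 0 y| ≤ M
  swap
  · refine hzero _ fun x => Real.iSup_of_not_bddAbove fun ⟨M, hMx⟩ => hM ?_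
    obtain ⟨C, hC⟩ := UU_diff hf h 0 x
    refine ⟨|c| * C + M, fun y hy => ?_⟩
    have h2 : |c * UU n f x y| ≤ M := hMx ⟨⟨y, by linarith⟩, rfl⟩
    calc |c * UU n f 0 y| = |c * (UU n f 0 y - UU n f x y) + c * UU n f x y| := by ring_nf
      _ ≤ |c * (UU n f 0 y - UU n f x y)| + |c * UU n f x y| := abs_add_le _ _
      _ ≤ _ := by
        rw [abs_mul]
        exact add_le_add (mul_le_mul_of_nonneg_left (hC y hy) (abs_nonneg _)) h2
  obtain ⟨M, hM⟩ := hM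
  have hge : ∀ᵐ x, |f x| ≤ ⨆ y : {y : ℝ // 0 < y}, |c * UU n f x y| := by
    filter_upwards [UU_tendsto hf h hc] with x hx
    obtain ⟨C, hC⟩ := UU_diff hf h x 0
    have hMx : ∀ y, 1 ≤ y → |c * UU n f x y| ≤ |c| * C + M := fun y hy => by
      calc |c * UU n f x y| = |c * (UU n f x y - UU n f 0 y) + c * UU n f 0 y| := by ring_nf
        _ ≤ |c * (UU n f x y - UU n f 0 y)| + |c * UU n f 0 y| := abs_add_le _ _
        _ ≤ _ := by
          rw [abs_mul]
          exact add_le_add (mul_le_mul_of_nonneg_left (hC y hy) (abs_nonneg _)) (hM y hy)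
    have hbdd := UU_bdd hf h hx hMx
    refine le_of_tendsto hx.abs ?_
    filter_upwards [self_mem_nhdsWithin] with y hy
    exact le_ciSup hbdd ⟨y, hy⟩
  unfold rearrange
  apply Real.sSup_of_not_bddAbove
  rintro ⟨b, hb⟩
  have hmem : max 0 (b + 1) ∈ {s : ℝ | 0 ≤ s ∧ ENNReal.ofReal t < volume {x | s <
      |(fun x => ⨆ y : {y : ℝ // 0 < y}, |c * UU n f x y|) x|}} := by
    refine ⟨le_max_left _ _, ?_⟩
    refine lt_of_lt_of_le ENNReal.ofReal_lt_top ?_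
    rw [← hinf (max 0 (b + 1))]
    refine measure_mono_ae ?_
    filter_upwards [hge] with x hx hs
    exact lt_of_lt_of_le (show max 0 (b + 1) < |f x| from hs) (hx.trans (le_abs_self _))
  have := hb hmem
  linarith [le_max_right 0 (b + 1)]

lemma poisson_max_le {n : ℕ} {f : EuclideanSpace ℝ (Fin n) → ℝ} (hf : Measurable f) {c : ℝ}
    (hc0 : c ≠ 0) (x : EuclideanSpace ℝ (Fin n)) :
    ENNReal.ofReal |(⨆ y : {y : ℝ // 0 < y}, |c * UU n f x y|)| ≤
      (‖c‖ₑ * (2 ^ (n + 2) * volume (ball (0 : EuclideanSpace ℝ (Fin n)) 1))) *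
        mx (fun x => ENNReal.ofReal |f x|) x := by
  set A := ‖c‖ₑ * (2 ^ (n + 2) * volume (ball (0 : EuclideanSpace ℝ (Fin n)) 1)) with hA
  set m := mx (fun x => ENNReal.ofReal |f x|) x with hm
  have hA0 : A ≠ 0 := mul_ne_zero (by simpa using hc0) (mul_ne_zero (by positivity) om_ne_zero)
  have hAt : A ≠ ∞ := ENNReal.mul_ne_top enorm_ne_top (ENNReal.mul_ne_top (by finiteness) om_ne_top)
  by_cases hmt : m = ∞
  · rw [hmt, ENNReal.mul_top hA0]; exact le_top
  have hfin : A * m ≠ ∞ := ENNReal.mul_ne_top hAt hmt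
  rw [abs_of_nonneg (Real.iSup_nonneg fun _ => abs_nonneg _), ENNReal.ofReal_le_iff_le_toReal hfin]
  refine Real.iSup_le (fun y => ?_) ENNReal.toReal_nonneg
  rw [← ENNReal.ofReal_le_iff_le_toReal hfin, ← Real.enorm_eq_ofReal_abs, enorm_mul, hA, mul_assoc]
  refine mul_le_mul_right ?_ _
  refine (enorm_integral_le_lintegral_enorm _).trans
    (le_trans (lintegral_mono fun ξ => ?_) (poisson_le_mx y.2 (hf.abs.ennreal_ofReal) x))
  rw [enorm_mul, Real.enorm_of_nonneg (pk_nonneg y.2 _), Real.enorm_eq_ofReal_abs]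


/-- Corollary 3.2, Poisson integral.  Under the assumptions of
Theorem 3.1 (with `Ω = ℝⁿ`, so `ℓ = ∞`), the maximal Poisson operator
`f ↦ sup_{y>0} |P_y f|`, where `P_y f(x) = ∫ P(x−ξ,y) f(ξ) dξ` with the Poisson kernel
`P(x,y) = c_n y (|x|² + y²)^{−(n+1)/2}`, is bounded in `L^{p(·),q(·)}_w(ℝⁿ)`. -/
theorem statement10 (n : ℕ) (hn : 0 < n)
    (p q γ : ℝ → ℝ) (p0 pinf q0 qinf γ0 γinf : ℝ)
    (hp : ClassPa 1 ∞ p p0 pinf) (hq : ClassPa 1 ∞ q q0 qinf)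
    (hp0 : 1 < p0) (hpinf : 1 < pinf)
    (hγ : ClassP ∞ γ γ0 γinf)
    (hγ0 : γ0 < 1 - 1 / p0) (hγinf : γinf < 1 - 1 / pinf)
    (w : ℝ → ℝ) (hw : ∀ t, w t = t ^ γ t)
    (c : ℝ)
    (hc : ∀ y : ℝ, 0 < y →
      ∫ x : EuclideanSpace ℝ (Fin n),
        c * y * ((‖x‖ ^ 2 + y ^ 2) ^ (-(((n : ℝ) + 1) / 2))) = 1) :
    ∃ C : ℝ≥0∞, 0 < C ∧ C < ∞ ∧
      ∀ f : EuclideanSpace ℝ (Fin n) → ℝ, Measurable f →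
        wLorentzNorm (volume : Measure (EuclideanSpace ℝ (Fin n))) w p q f < ∞ →
        wLorentzNorm (volume : Measure (EuclideanSpace ℝ (Fin n))) w p q
            (fun x => ⨆ y : {y : ℝ // 0 < y},
              |∫ ξ, c * (y : ℝ) * ((‖x - ξ‖ ^ 2 + (y : ℝ) ^ 2) ^ (-(((n : ℝ) + 1) / 2)))
                  * f ξ|)
          ≤ C * wLorentzNorm (volume : Measure (EuclideanSpace ℝ (Fin n))) w p q f := by
  have hc1 : ∀ y : ℝ, 0 < y → ∫ x : EuclideanSpace ℝ (Fin n), c * pk n y x = 1 := by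
    intro y hy
    rw [← hc y hy]
    congr 1; ext x; unfold pk; ring
  have hc0 : c ≠ 0 := by
    rintro rfl
    have := hc1 1 one_pos
    simp at this
  have : Nonempty (Fin n) := ⟨⟨0, hn⟩⟩
  have hvol : (volume : Measure (EuclideanSpace ℝ (Fin n))) univ = ∞ :=
    measure_univ_of_isAddLeftInvariant _
  set A := ‖c‖ₑ * (2 ^ (n + 2) * volume (ball (0 : EuclideanSpace ℝ (Fin n)) 1)) with hA
  have hA0 : A ≠ 0 := mul_ne_zero (by simpa using hc0) (mul_ne_zero (by positivity) om_ne_zero)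
  have hAt : A ≠ ∞ := ENNReal.mul_ne_top enorm_ne_top (ENNReal.mul_ne_top (by finiteness) om_ne_top)
  obtain ⟨C, hC0, hCt, hC⟩ := lux_bound p q γ p0 pinf q0 qinf γ0 γinf hp hq hγ hγ0 hγinf w hw
    (A * (1 + 4 ^ n)) (mul_ne_zero hA0 (by positivity)) (ENNReal.mul_ne_top hAt (by finiteness))
  refine ⟨C, hC0, hCt, fun f hf _ => ?_⟩
  have hN : (fun x : EuclideanSpace ℝ (Fin n) => ⨆ y : {y : ℝ // 0 < y},
      |∫ ξ, c * (y : ℝ) * ((‖x - ξ‖ ^ 2 + (y : ℝ) ^ 2) ^ (-(((n : ℝ) + 1) / 2))) * f ξ|) =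
      fun x => ⨆ y : {y : ℝ // 0 < y}, |c * UU n f x y| := by
    ext x
    congr 1; ext y
    unfold UU
    rw [← integral_const_mul]
    congr 2; ext ξ; unfold pk; ring
  rw [hN]
  unfold wLorentzNorm
  rw [hvol]
  have hnn : ∀ (g : EuclideanSpace ℝ (Fin n) → ℝ) (t : ℝ), 0 ≤ rearrange volume g t :=
    fun g t => Real.sSup_nonneg fun s hs => hs.1
  by_cases hinf : ∀ s : ℝ, volume {x | s < |f x|} = ∞
  · refine hC (fun _ => 0) _ _ antitone_const (hnn f) (hnn _) (fun _ _ => zero_le) fun t _ => ?_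
    rw [junk_case hf hc1 hinf t]; simp
  · push Not at hinf
    obtain ⟨s0, hs0⟩ := hinf
    exact hC (FF volume f) _ _ (FF_antitone _ _) (hnn f) (hnn _)
      (fun t ht => FF_le_rearrange hf hs0 ht)
      (fun t ht => rearrange_bound hn hf hs0 hA0 hAt (poisson_max_le hf hc0) ht)

end
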